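/- arXiv:1605.02891 — 2 statements merged into one kernel-verified Lean document; each statement's English description precedes it below -/
import Mathlib

section
/- The class of fan-planar graphs is not closed under path-addition: there exist a fan-planar finite simple graph G, distinct vertices u, v of G, and a path P of length at least |V(G)|−1 from u to v whose internal vertices are new, such that for every supplementary edge set F the graph G ⊕ P ⊕ F is not fan-planar (a witness is obtained from the 2-planar non-fan-planar graph of Binucci et al. by deleting two edges and re-adding them as vertex-disjoint paths). -/
/-- Points of the plane `ℝ²`. -/
abbrev Plane : Type := ℝ × ℝ

/-- The `i`-th vertex of a path from `a` to `b` whose internal vertices are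
`w 0, …, w (t-1)` (so the path has length `t + 1`). -/
def chainVertex {α : Type*} (a b : α) {t : ℕ} (w : Fin t → α) (i : Fin (t + 2)) : α :=
  if _h0 : (i : ℕ) = 0 then a
  else if _h1 : (i : ℕ) = t + 1 then b
  else w ⟨(i : ℕ) - 1, by have := i.isLt; omega⟩

/-- The edge set of a path from `a` to `b` through the internal vertices
`w 0, …, w (t-1)`. -/
def chainEdges {α : Type*} (a b : α) {t : ℕ} (w : Fin t → α) : Set (Sym2 α) :=
  {e | ∃ i : Fin (t + 1),
    e = s(chainVertex a b w (Fin.castSucc i), chainVertex a b w (Fin.succ i))}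

/-- Path-addition `G ⊕ P ⊕ F`: the graph on `V ⊕ Fin t` obtained from `G` by adding an
internally vertex-disjoint path `P = (u, w₁, …, w_t, v)` with `t` new internal vertices
together with a set `F` of supplementary edges. -/
def pathAdd {V : Type*} (G : SimpleGraph V) (u v : V) (t : ℕ)
    (F : Set (Sym2 (V ⊕ Fin t))) : SimpleGraph (V ⊕ Fin t) :=
  SimpleGraph.fromEdgeSet
    ((Sym2.map Sum.inl '' G.edgeSet)
      ∪ chainEdges (Sum.inl u) (Sum.inl v) (fun i => Sum.inr i)
      ∪ F)

/-- A valid supplementary edge set: every supplementary edge is a non-loop with at least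
one endpoint among the internal vertices `w₁, …, w_t` of the added path. -/
def ValidSupp {V : Type*} {t : ℕ} (F : Set (Sym2 (V ⊕ Fin t))) : Prop :=
  ∀ e ∈ F, ¬ e.IsDiag ∧ ∃ i : Fin t, Sum.inr i ∈ e

/-- A drawing of a finite simple graph `G` in the plane: vertices are mapped to distinct
points, each edge to a continuous injective curve (parametrized over `[0,1]`) joining the
points of its endpoints, whose interior contains no vertex point; curves of two distinct
edges meet in finitely many points, and curves of edges sharing an endpoint meet only at
(the point of) that endpoint. -/
structure Drawing {V : Type*} (G : SimpleGraph V) where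
  pos : V → Plane
  curve : Sym2 V → ℝ → Plane
  pos_inj : Function.Injective pos
  curve_cont : ∀ e ∈ G.edgeSet, ContinuousOn (curve e) (Set.Icc 0 1)
  curve_inj : ∀ e ∈ G.edgeSet, Set.InjOn (curve e) (Set.Icc 0 1)
  curve_ends : ∀ x y : V, G.Adj x y →
    ({curve s(x, y) 0, curve s(x, y) 1} : Set Plane) = {pos x, pos y}
  no_vertex_interior : ∀ e ∈ G.edgeSet, ∀ s ∈ Set.Ioo (0 : ℝ) 1, ∀ x : V, curve e s ≠ pos x
  finite_meets : ∀ e ∈ G.edgeSet, ∀ f ∈ G.edgeSet, e ≠ f →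
    (curve e '' Set.Icc 0 1 ∩ curve f '' Set.Icc 0 1).Finite
  shared_endpoint : ∀ e ∈ G.edgeSet, ∀ f ∈ G.edgeSet, e ≠ f → ∀ x : V, x ∈ e → x ∈ f →
    curve e '' Set.Icc 0 1 ∩ curve f '' Set.Icc 0 1 ⊆ {pos x}

/-- `p` is a crossing point of the edges `e` and `f`: a point interior to both curves. -/
def Drawing.IsCrossingPt {V : Type*} {G : SimpleGraph V} (D : Drawing G)
    (e f : Sym2 V) (p : Plane) : Prop :=
  e ∈ G.edgeSet ∧ f ∈ G.edgeSet ∧ e ≠ f ∧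
    (∃ s ∈ Set.Ioo (0 : ℝ) 1, D.curve e s = p) ∧
    (∃ s ∈ Set.Ioo (0 : ℝ) 1, D.curve f s = p)

/-- Two edges cross in the drawing `D`. -/
def Drawing.Crosses {V : Type*} {G : SimpleGraph V} (D : Drawing G) (e f : Sym2 V) : Prop :=
  ∃ p : Plane, D.IsCrossingPt e f p

/-- The drawing `D` is crossing-free. -/
def Drawing.CrossingFree {V : Type*} {G : SimpleGraph V} (D : Drawing G) : Prop :=
  ∀ e f : Sym2 V, ¬ D.Crosses e f

/-- A graph is planar if it admits a crossing-free drawing in the plane. -/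
def IsPlanarGraph {V : Type*} (G : SimpleGraph V) : Prop :=
  ∃ D : Drawing G, D.CrossingFree

/-- A drawing is fan-planar if for every edge `e` all edges that cross `e` are incident
to one common vertex (they form a fan). -/
def Drawing.FanPlanar {V : Type*} {G : SimpleGraph V} (D : Drawing G) : Prop :=
  ∀ e ∈ G.edgeSet, (∃ f : Sym2 V, D.Crosses e f) →
    ∃ x : V, ∀ f : Sym2 V, D.Crosses e f → x ∈ f

/-- A graph is fan-planar if it admits a fan-planar drawing. -/
def IsFanPlanarGraph {V : Type*} (G : SimpleGraph V) : Prop :=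
  ∃ D : Drawing G, D.FanPlanar

/-- A nonvanishing continuous function on the plane has a continuous logarithm. -/
theorem exists_log_lift (F : ℝ × ℝ → ℂ) (hF : Continuous F) (h0 : ∀ q, F q ≠ 0) :
    ∃ L : ℝ × ℝ → ℂ, Continuous L ∧ ∀ q, Complex.exp (L q) = F q := by
  obtain ⟨L, ⟨-, hL⟩, -⟩ := Complex.isCoveringMapOn_exp.existsUnique_continuousMap_lifts
    (A := ℝ × ℝ) (f := ⟨F, hF⟩) (a₀ := (0, 0)) (e₀ := Complex.log (F (0, 0)))
    (Complex.exp_log (h0 _)) (fun a => h0 a)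
  exact ⟨L, L.continuous, fun q => congrFun hL q⟩

/-- Two logarithms (up to a constant factor) have the same increment. -/
theorem log_increment_unique (f g : ℝ → ℂ) (hf : Continuous f) (hg : Continuous g) (c : ℂ)
    (h : ∀ s, Complex.exp (f s) = c * Complex.exp (g s)) : f 1 - f 0 = g 1 - g 0 := by
  have hcon : (fun s : ℝ => f s - g s) = fun _ => f 0 - g 0 := by
    refine Complex.isCoveringMap_exp.eq_of_comp_eq (by fun_prop) continuous_const ?_ 0 rfl
    funext s
    have hs : ∀ s, Complex.exp (f s - g s) = c := fun s => by
      rw [Complex.exp_sub, h s, mul_div_cancel_right₀ _ (Complex.exp_ne_zero _)]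
    exact Subtype.ext ((hs s).trans (hs 0).symm)
  have h10 : f 1 - g 1 = f 0 - g 0 := congrFun hcon 1
  linear_combination h10

/-- The increment of the logarithm of a curve around a point. -/
noncomputable def logInc (γ : ℝ → ℂ) (p : ℂ) : ℂ :=
  open Classical in
  if h : ∃ L : ℝ → ℂ, Continuous L ∧ ∀ s, Complex.exp (L s) = γ s - p then
    h.choose 1 - h.choose 0 else 0

theorem logInc_eq (γ : ℝ → ℂ) (p : ℂ) (L : ℝ → ℂ) (hL : Continuous L) (c : ℂ)
    (h : ∀ s, Complex.exp (L s) = c * (γ s - p)) : logInc γ p = L 1 - L 0 := by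
  have hc : c ≠ 0 := by
    rintro rfl
    exact Complex.exp_ne_zero (L 0) (by simpa using h 0)
  have hex : ∃ L : ℝ → ℂ, Continuous L ∧ ∀ s, Complex.exp (L s) = γ s - p := by
    refine ⟨fun s => L s - Complex.log c, by fun_prop, fun s => ?_⟩
    rw [Complex.exp_sub, h s, Complex.exp_log hc, mul_div_cancel_left₀ _ hc]
  unfold logInc
  rw [dif_pos hex]
  symm
  exact log_increment_unique _ _ hL hex.choose_spec.1 c fun s => by
    rw [h s, hex.choose_spec.2 s]

theorem exists_logInc_eq (γ : ℝ → ℂ) (hγ : Continuous γ) (p : ℂ) (hp : ∀ s, γ s ≠ p)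
    (u v : ℂ) (hu : Complex.exp u = γ 0 - p) (hv : Complex.exp v = γ 1 - p) :
    ∃ n : ℤ, logInc γ p = v - u + n * (2 * Real.pi * Complex.I) := by
  obtain ⟨L, hL, hLe⟩ := exists_log_lift (fun q => γ q.1 - p) (by fun_prop)
    (fun q => sub_ne_zero.2 (hp _))
  have h1 : logInc γ p = L (1, 0) - L (0, 0) :=
    logInc_eq γ p (fun s => L (s, 0)) (by fun_prop) 1 fun s => by simp [hLe]
  have h2 : Complex.exp (logInc γ p) = Complex.exp (v - u) := by
    rw [h1, Complex.exp_sub, Complex.exp_sub, hLe, hLe, hu, hv]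
  exact (Complex.exp_eq_exp_iff_exists_int).1 h2

/-- The key relation for two disjoint curves. -/
theorem logInc_disjoint (α β : ℝ → ℂ) (hα : Continuous α) (hβ : Continuous β)
    (hd : ∀ s t, α s ≠ β t) :
    logInc α (β 1) - logInc α (β 0) - logInc β (α 1) + logInc β (α 0) = 0 := by
  obtain ⟨L, hL, hLe⟩ := exists_log_lift (fun q => α q.1 - β q.2) (by fun_prop)
    (fun q => sub_ne_zero.2 (hd _ _))
  rw [logInc_eq α (β 1) (fun s => L (s, 1)) (by fun_prop) 1 fun s => by simp [hLe],
    logInc_eq α (β 0) (fun s => L (s, 0)) (by fun_prop) 1 fun s => by simp [hLe],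
    logInc_eq β (α 1) (fun s => L (1, s)) (by fun_prop) (-1) fun s => by simp [hLe],
    logInc_eq β (α 0) (fun s => L (0, s)) (by fun_prop) (-1) fun s => by simp [hLe]]
  ring

/-- `K_{3,3}` is not planar, in a strong form: in any continuous placement of `K_{3,3}`
in the plane, two independent edges meet. -/
theorem k33_complex (a b : Fin 3 → ℂ) (γ : Fin 3 → Fin 3 → ℝ → ℂ)
    (hc : ∀ i j, Continuous (γ i j)) (h0 : ∀ i j, γ i j 0 = a i) (h1 : ∀ i j, γ i j 1 = b j)
    (hd : ∀ i j k l, i ≠ k → j ≠ l → ∀ s t, γ i j s ≠ γ k l t) : False := by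
  -- chosen logarithms
  obtain ⟨A, hA⟩ : ∃ A : Fin 3 → Fin 3 → ℂ, ∀ i k, A i k =
      if i < k then Complex.log (a i - a k) else Complex.log (a k - a i) + Real.pi * Complex.I :=
    ⟨_, fun _ _ => rfl⟩
  obtain ⟨B, hB⟩ : ∃ B : Fin 3 → Fin 3 → ℂ, ∀ i k, B i k =
      if i < k then Complex.log (b i - b k) else Complex.log (b k - b i) + Real.pi * Complex.I :=
    ⟨_, fun _ _ => rfl⟩
  have haa : ∀ i k, i ≠ k → a i ≠ a k := by
    intro i k hik
    have := hd i 0 k 1 hik (by decide) 0 0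
    rwa [h0, h0] at this
  have hbb : ∀ i k, i ≠ k → b i ≠ b k := by
    intro i k hik
    have := hd 0 i 1 k (by decide) hik 1 1
    rwa [h1, h1] at this
  have hab : ∀ i k, a i ≠ b k := by
    intro i k
    obtain ⟨j, hj⟩ : ∃ j : Fin 3, j ≠ k := exists_ne k
    obtain ⟨l, hl⟩ : ∃ j : Fin 3, j ≠ i := exists_ne i
    have := hd i j l k hl.symm hj 0 1
    rwa [h0, h1] at this
  have hneg : ∀ z : ℂ, z ≠ 0 → Complex.exp (Complex.log z + Real.pi * Complex.I) = -z := by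
    intro z hz
    rw [Complex.exp_add, Complex.exp_log hz, Complex.exp_pi_mul_I]; ring
  have eA : ∀ i k, i ≠ k → Complex.exp (A i k) = a i - a k := by
    intro i k hik
    rw [hA]
    split_ifs
    · exact Complex.exp_log (sub_ne_zero.2 (haa _ _ hik))
    · rw [hneg _ (sub_ne_zero.2 (haa _ _ hik.symm))]; ring
  have eB : ∀ i k, i ≠ k → Complex.exp (B i k) = b i - b k := by
    intro i k hik
    rw [hB]
    split_ifs
    · exact Complex.exp_log (sub_ne_zero.2 (hbb _ _ hik))
    · rw [hneg _ (sub_ne_zero.2 (hbb _ _ hik.symm))]; ring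
  have eAB : ∀ i k, Complex.exp (Complex.log (a i - b k)) = a i - b k := fun i k =>
    Complex.exp_log (sub_ne_zero.2 (hab _ _))
  have eBA : ∀ i k, Complex.exp (Complex.log (a i - b k) + Real.pi * Complex.I) = b k - a i :=
    fun i k => by rw [hneg _ (sub_ne_zero.2 (hab _ _))]; ring
  -- integers
  have N : ∀ i j k, ∃ n : ℤ, k ≠ i → logInc (γ i j) (a k) =
      (Complex.log (a k - b j) + Real.pi * Complex.I) - A i k + n * (2 * Real.pi * Complex.I) := by
    intro i j k
    by_cases hk : k = i
    · exact ⟨0, fun h => absurd hk h⟩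
    obtain ⟨l, hl⟩ : ∃ l : Fin 3, l ≠ j := exists_ne j
    obtain ⟨n, hn⟩ := exists_logInc_eq (γ i j) (hc i j) (a k)
      (fun s => by have := hd i j k l (Ne.symm hk) hl.symm s 0; rwa [h0] at this)
      (A i k) (Complex.log (a k - b j) + Real.pi * Complex.I)
      (by rw [eA _ _ (Ne.symm hk), h0]) (by rw [eBA, h1])
    exact ⟨n, fun _ => hn⟩
  have M : ∀ i j l, ∃ n : ℤ, l ≠ j → logInc (γ i j) (b l) =
      B j l - Complex.log (a i - b l) + n * (2 * Real.pi * Complex.I) := by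
    intro i j l
    by_cases hl : l = j
    · exact ⟨0, fun h => absurd hl h⟩
    obtain ⟨k, hk⟩ : ∃ k : Fin 3, k ≠ i := exists_ne i
    obtain ⟨n, hn⟩ := exists_logInc_eq (γ i j) (hc i j) (b l)
      (fun s => by have := hd i j k l hk.symm (Ne.symm hl) s 1; rwa [h1] at this)
      (Complex.log (a i - b l)) (B j l)
      (by rw [eAB, h0]) (by rw [eB _ _ (Ne.symm hl), h1])
    exact ⟨n, fun _ => hn⟩
  choose n hn using N
  choose m hm using M
  have hpi : (2 * Real.pi * Complex.I : ℂ) ≠ 0 := Complex.two_pi_I_ne_zero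
  have key1 : ∀ i j k l, i < k → j < l →
      -1 + m i j l - n i j k - m k l j + n k l i = 0 := by
    intro i j k l hik hjl
    have h := logInc_disjoint (γ i j) (γ k l) (hc _ _) (hc _ _) (hd i j k l hik.ne hjl.ne)
    rw [h0, h0, h1, h1, hm i j l hjl.ne', hn i j k hik.ne', hm k l j hjl.ne, hn k l i hik.ne,
      hA, hA, hB, hB, if_pos hik, if_pos hjl, if_neg hik.not_gt, if_neg hjl.not_gt] at h
    have h2 : ((-1 + m i j l - n i j k - m k l j + n k l i : ℤ) : ℂ) * (2 * Real.pi * Complex.I)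
        = 0 := by
      push_cast
      linear_combination h
    exact_mod_cast (mul_eq_zero.1 h2).resolve_right hpi
  have key2 : ∀ i j k l, i < k → l < j →
      m i j l - n i j k - m k l j + n k l i = 0 := by
    intro i j k l hik hjl
    have h := logInc_disjoint (γ i j) (γ k l) (hc _ _) (hc _ _) (hd i j k l hik.ne hjl.ne')
    rw [h0, h0, h1, h1, hm i j l hjl.ne, hn i j k hik.ne', hm k l j hjl.ne', hn k l i hik.ne,
      hA, hA, hB, hB, if_pos hik, if_pos hjl, if_neg hik.not_gt, if_neg hjl.not_gt] at h
    have h2 : ((m i j l - n i j k - m k l j + n k l i : ℤ) : ℂ) * (2 * Real.pi * Complex.I)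
        = 0 := by
      push_cast
      linear_combination h
    exact_mod_cast (mul_eq_zero.1 h2).resolve_right hpi
  have l01 : (0 : Fin 3) < 1 := by decide
  have l02 : (0 : Fin 3) < 2 := by decide
  have l12 : (1 : Fin 3) < 2 := by decide
  have e1 := key1 0 0 1 1 l01 l01
  have e2 := key1 0 0 1 2 l01 l02
  have e3 := key1 0 1 1 2 l01 l12
  have e4 := key1 0 0 2 1 l02 l01
  have e5 := key1 0 0 2 2 l02 l02
  have e6 := key1 0 1 2 2 l02 l12
  have e7 := key1 1 0 2 1 l12 l01
  have e8 := key1 1 0 2 2 l12 l02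
  have e9 := key1 1 1 2 2 l12 l12
  have f1 := key2 0 1 1 0 l01 l01
  have f2 := key2 0 2 1 0 l01 l02
  have f3 := key2 0 2 1 1 l01 l12
  have f4 := key2 0 1 2 0 l02 l01
  have f5 := key2 0 2 2 0 l02 l02
  have f6 := key2 0 2 2 1 l02 l12
  have f7 := key2 1 1 2 0 l12 l01
  have f8 := key2 1 2 2 0 l12 l02
  have f9 := key2 1 2 2 1 l12 l12
  clear key1 key2
  omega

/-- Strong nonplanarity of `K_{3,3}`, for connecting sets in the plane. -/
theorem k33_joined (a b : Fin 3 → Plane) (S : Fin 3 → Fin 3 → Set Plane)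
    (hS : ∀ i j, JoinedIn (S i j) (a i) (b j))
    (hd : ∀ i j k l, i ≠ k → j ≠ l → Disjoint (S i j) (S k l)) : False := by
  have hex : ∀ i j, ∃ γ : ℝ → ℂ, Continuous γ ∧ γ 0 = Complex.equivRealProdCLM.symm (a i) ∧
      γ 1 = Complex.equivRealProdCLM.symm (b j) ∧
      ∀ s, Complex.equivRealProdCLM (γ s) ∈ S i j := by
    intro i j
    obtain ⟨γ, hγ⟩ := hS i j
    refine ⟨fun s => Complex.equivRealProdCLM.symm (γ.extend s), ?_, ?_, ?_, ?_⟩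
    · exact Complex.equivRealProdCLM.symm.continuous.comp γ.continuous_extend
    · simp
    · simp
    · intro s
      rw [ContinuousLinearEquiv.apply_symm_apply]
      exact hγ _
  choose γ h1 h2 h3 h4 using hex
  refine k33_complex _ _ γ h1 h2 h3 ?_
  intro i j k l hik hjl s t heq
  refine Set.disjoint_left.1 (hd i j k l hik hjl) (h4 i j s) ?_
  rw [heq]; exact h4 k l t

/-- The part of the plane covered by the subgraph induced on `T`. -/
def Drawing.region {V : Type*} {G : SimpleGraph V} (D : Drawing G) (T : Set V) : Set Plane :=
  {q | (∃ v ∈ T, q = D.pos v) ∨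
    ∃ x ∈ T, ∃ y ∈ T, G.Adj x y ∧ q ∈ D.curve s(x, y) '' Set.Icc 0 1}

theorem Drawing.joinedIn_edge {V : Type*} {G : SimpleGraph V} (D : Drawing G) {x y : V}
    (h : G.Adj x y) : JoinedIn (D.curve s(x, y) '' Set.Icc 0 1) (D.pos x) (D.pos y) := by
  have hj : JoinedIn (D.curve s(x, y) '' Set.Icc 0 1) (D.curve s(x, y) 0) (D.curve s(x, y) 1) :=
    JoinedIn.ofLine (D.curve_cont _ h) rfl rfl subset_rfl
  have he := D.curve_ends x y h
  rcases Set.pair_eq_pair_iff.1 he with ⟨h0, h1⟩ | ⟨h0, h1⟩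
  · rwa [h0, h1] at hj
  · rw [h0, h1] at hj; exact hj.symm

theorem Drawing.joinedIn_walk {V : Type*} {G : SimpleGraph V} (D : Drawing G) (T : Set V)
    {x y : V} (w : G.Walk x y) (hw : ∀ v ∈ w.support, v ∈ T) :
    JoinedIn (D.region T) (D.pos x) (D.pos y) := by
  induction w with
  | nil => exact JoinedIn.refl (Or.inl ⟨_, hw _ (by simp), rfl⟩)
  | cons h w ih =>
    refine JoinedIn.trans ((D.joinedIn_edge h).mono ?_) (ih fun v hv => hw v (by simp [hv]))
    intro q hq
    exact Or.inr ⟨_, hw _ (by simp), _, hw _ (by simp), h, hq⟩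

/-- A point of a closed edge curve is the point of an end vertex or an interior point. -/
theorem Drawing.mem_curve {V : Type*} {G : SimpleGraph V} (D : Drawing G) {x y : V}
    (h : G.Adj x y) {q : Plane} (hq : q ∈ D.curve s(x, y) '' Set.Icc 0 1) :
    q = D.pos x ∨ q = D.pos y ∨ ∃ s ∈ Set.Ioo (0 : ℝ) 1, D.curve s(x, y) s = q := by
  obtain ⟨s, hs, rfl⟩ := hq
  have he := D.curve_ends x y h
  have h0 : D.curve s(x, y) 0 ∈ ({D.pos x, D.pos y} : Set Plane) := by rw [← he]; simp
  have h1 : D.curve s(x, y) 1 ∈ ({D.pos x, D.pos y} : Set Plane) := by rw [← he]; simp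
  simp only [Set.mem_insert_iff, Set.mem_singleton_iff] at h0 h1
  rcases hs.1.eq_or_lt with rfl | h2
  · tauto
  rcases hs.2.eq_or_lt with rfl | h3
  · tauto
  · exact Or.inr (Or.inr ⟨s, ⟨h2, h3⟩, rfl⟩)

theorem Drawing.region_cases {V : Type*} {G : SimpleGraph V} (D : Drawing G) (T : Set V)
    {q : Plane} (hq : q ∈ D.region T) : (∃ v ∈ T, q = D.pos v) ∨
    ∃ x ∈ T, ∃ y ∈ T, G.Adj x y ∧ ∃ s ∈ Set.Ioo (0 : ℝ) 1, D.curve s(x, y) s = q := by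
  rcases hq with h | ⟨x, hx, y, hy, hxy, hq⟩
  · exact Or.inl h
  · rcases D.mem_curve hxy hq with h | h | h
    · exact Or.inl ⟨x, hx, h⟩
    · exact Or.inl ⟨y, hy, h⟩
    · exact Or.inr ⟨x, hx, y, hy, hxy, h⟩

theorem Drawing.region_meet {V : Type*} {G : SimpleGraph V} (D : Drawing G) (T T' : Set V)
    (hT : Disjoint T T') (h : ¬ Disjoint (D.region T) (D.region T')) :
    ∃ x ∈ T, ∃ y ∈ T, ∃ x' ∈ T', ∃ y' ∈ T', G.Adj x y ∧ D.Crosses s(x, y) s(x', y') := by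
  obtain ⟨q, h1, h2⟩ := Set.not_disjoint_iff.1 h
  rcases D.region_cases T h1 with ⟨v, hv, hq⟩ | ⟨x, hx, y, hy, hxy, s, hs, hq⟩
  · rcases D.region_cases T' h2 with ⟨v', hv', hq'⟩ | ⟨x', hx', y', hy', hxy', s', hs', hq'⟩
    · have : v = v' := D.pos_inj (hq.symm.trans hq')
      subst this
      exact absurd hv' (Set.disjoint_left.1 hT hv)
    · exact absurd (hq'.trans hq) (D.no_vertex_interior _ hxy' s' hs' v)
  · rcases D.region_cases T' h2 with ⟨v', hv', hq'⟩ | ⟨x', hx', y', hy', hxy', s', hs', hq'⟩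
    · exact absurd (hq.trans hq') (D.no_vertex_interior _ hxy s hs v')
    · refine ⟨x, hx, y, hy, x', hx', y', hy', hxy, q, hxy, hxy', ?_, ⟨s, hs, hq⟩, ⟨s', hs', hq'⟩⟩
      intro he
      have : x ∈ s(x', y') := by rw [← he]; simp
      rcases Sym2.mem_iff.1 this with rfl | rfl
      · exact Set.disjoint_left.1 hT hx hx'
      · exact Set.disjoint_left.1 hT hx hy'

/-- Few clones point to each other: three pairwise unrelated clones exist. -/
theorem exists_three {V : Type*} {N : ℕ} (S : Finset (Fin N)) (hS : 18 < S.card)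
    (p f g : Fin N → V) (hp : Function.Injective p) :
    ∃ i : Fin 3 → Fin N, (∀ x, i x ∈ S) ∧ ∀ x y, x ≠ y →
      p (i x) ≠ p (i y) ∧ f (i x) ≠ p (i y) ∧ g (i x) ≠ p (i y) := by
  classical
  by_contra hcon
  push Not at hcon
  let F : Fin 3 → Fin N → V := ![p, f, g]
  let bad : (Fin 3 × Fin 3 × Fin 3) → Finset (Fin 3 → Fin N) := fun c =>
    (Fintype.piFinset (fun _ => S)).filter (fun t => c.1 ≠ c.2.1 ∧ F c.2.2 (t c.1) = p (t c.2.1))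
  have hbad : ∀ c, (bad c).card ≤ if c.1 ≠ c.2.1 then S.card ^ 2 else 0 := by
    rintro ⟨x, y, k⟩
    split_ifs with hxy
    · simp only at hxy
      have h1 : (bad (x, y, k)).card ≤
          (Fintype.piFinset (fun _ : {u : Fin 3 // u ≠ y} => S)).card := by
        refine Finset.card_le_card_of_injOn (fun t u => t u.1) ?_ ?_
        · intro t ht
          simp only [bad, Finset.coe_filter, Fintype.mem_piFinset, Set.mem_ofPred_eq] at ht
          simp only [Finset.mem_coe, Fintype.mem_piFinset]
          exact fun u => ht.1 u.1
        · intro t ht t' ht' htt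
          simp only [bad, Finset.coe_filter, Fintype.mem_piFinset, Set.mem_ofPred_eq] at ht ht'
          funext u
          by_cases hu : u = y
          · subst hu
            apply hp
            have hx : t x = t' x := congrFun htt ⟨x, hxy⟩
            rw [← ht.2.2, ← ht'.2.2, hx]
          · exact congrFun htt ⟨u, hu⟩
      refine h1.trans ?_
      simp [Fintype.card_piFinset, Fintype.card_subtype_compl]
    · simp only [ne_eq, not_not] at hxy
      simp [bad, hxy]
  have hsub : Fintype.piFinset (fun _ : Fin 3 => S) ⊆ Finset.univ.biUnion bad := by
    intro t ht
    rw [Fintype.mem_piFinset] at ht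
    obtain ⟨x, y, hxy, h⟩ := hcon t ht
    simp only [Finset.mem_biUnion, Finset.mem_univ, true_and, bad, Finset.mem_filter,
      Fintype.mem_piFinset]
    by_cases h0 : p (t x) = p (t y)
    · exact ⟨(x, y, 0), ht, hxy, h0⟩
    by_cases h1 : f (t x) = p (t y)
    · exact ⟨(x, y, 1), ht, hxy, h1⟩
    · exact ⟨(x, y, 2), ht, hxy, h h0 h1⟩
  have hcard := (Finset.card_le_card hsub).trans (Finset.card_biUnion_le)
  have h2 := hcard.trans (Finset.sum_le_sum fun c _ => hbad c)
  rw [Fintype.card_piFinset, Finset.prod_const, Finset.card_univ, Fintype.card_fin,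
    Finset.sum_ite, Finset.sum_const, Finset.sum_const_zero,
    show (Finset.univ.filter (fun c : Fin 3 × Fin 3 × Fin 3 => c.1 ≠ c.2.1)).card = 18 by decide]
    at h2
  simp only [smul_eq_mul, add_zero] at h2
  have h3 : S.card ^ 3 = S.card * S.card ^ 2 := by ring
  have h4 : 0 < S.card ^ 2 := by positivity
  nlinarith

/-- The topological core: a hard `K_{3,40}` together with `121` soft apices is not fan-planar. -/
theorem core_not_fanPlanar {V : Type*} (G : SimpleGraph V) (a : Fin 3 → V) (p : Fin 40 → V)
    (z : Fin 121 → V) (col : V → Option (Fin 121)) (ha : Function.Injective a)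
    (hp : Function.Injective p) (hca : ∀ k, col (a k) = none) (hcp : ∀ i, col (p i) = none)
    (hadj : ∀ k i, G.Adj (a k) (p i))
    (hw : ∀ i j, ∃ w : G.Walk (p i) (z j), ∀ v ∈ w.support, v = p i ∨ col v = some j) :
    ¬ IsFanPlanarGraph G := by
  classical
  rintro ⟨D, hD⟩
  have hcen : ∀ e : Sym2 V, ∃ c : V, e ∈ G.edgeSet → ∀ f, D.Crosses e f → c ∈ f := by
    intro e
    by_cases he : e ∈ G.edgeSet ∧ ∃ f, D.Crosses e f
    · obtain ⟨c, hc⟩ := hD e he.1 he.2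
      exact ⟨c, fun _ => hc⟩
    · exact ⟨a 0, fun h f hf => absurd ⟨h, f, hf⟩ he⟩
  choose cen hcen using hcen
  -- an apex copy which is not the centre of any hard edge
  obtain ⟨j, hj⟩ : ∃ j : Fin 121, ∀ k i, col (cen s(a k, p i)) ≠ some j := by
    by_contra hcon
    push Not at hcon
    choose k i hki using hcon
    have hinj : Function.Injective (fun j => (k j, i j)) := by
      intro j j' h
      simp only [Prod.mk.injEq] at h
      have h1 := hki j
      rw [h.1, h.2, hki j'] at h1
      exact (Option.some.inj h1).symm
    have := Fintype.card_le_of_injective _ hinj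
    simp at this
  have hap : ∀ k i, a k ≠ p i := fun k i => (hadj k i).ne
  have h12 : a 1 ≠ a 2 := fun h => absurd (ha h) (by decide)
  -- choose the second hard vertex
  obtain ⟨l, hl0, S, hS, hSl⟩ : ∃ l : Fin 3, l ≠ 0 ∧ ∃ S : Finset (Fin 40), 18 < S.card ∧
      ∀ i ∈ S, cen s(a 0, p i) ≠ a l := by
    by_cases hc : 18 < (Finset.univ.filter (fun i => cen s(a 0, p i) ≠ a 1)).card
    · exact ⟨1, by decide, _, hc, fun i hi => (Finset.mem_filter.1 hi).2⟩
    · refine ⟨2, by decide, Finset.univ.filter (fun i => ¬ cen s(a 0, p i) ≠ a 1), ?_, ?_⟩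
      · have := Finset.card_filter_add_card_filter_not
          (s := (Finset.univ : Finset (Fin 40))) (fun i => cen s(a 0, p i) ≠ a 1)
        rw [Finset.card_univ, Fintype.card_fin] at this
        omega
      · intro i hi
        have h := (Finset.mem_filter.1 hi).2
        rw [not_not] at h
        rw [h]; exact h12
  obtain ⟨i, hiS, hi⟩ := exists_three S hS p (fun i => cen s(a 0, p i)) (fun i => cen s(a l, p i)) hp
  have hii : ∀ x y, x ≠ y → p (i x) ≠ p (i y) := fun x y h => (hi x y h).1
  have hal : a 0 ≠ a l := fun h => hl0 (ha h).symm
  let T : Fin 3 → Fin 3 → Set V := fun x y => ![{a 0, p (i y)}, {a l, p (i y)},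
    {v | v = p (i y) ∨ col v = some j}] x
  let A : Fin 3 → V := ![a 0, a l, z j]
  have hT0 : ∀ y, T 0 y = {a 0, p (i y)} := fun y => rfl
  have hT1 : ∀ y, T 1 y = {a l, p (i y)} := fun y => rfl
  have hT2 : ∀ y, T 2 y = {v | v = p (i y) ∨ col v = some j} := fun y => rfl
  -- disjointness for increasing pairs
  have hdis : ∀ x x' y y', x < x' → y ≠ y' → Disjoint (T x y) (T x' y') := by
    intro x x' y y' hxx hyy
    rw [Set.disjoint_left]
    have hne := hii y y' hyy
    fin_cases x <;> fin_cases x' <;>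
      first
      | exact absurd hxx (by decide)
      | (intro v hv hv'
         simp only [T, Fin.zero_eta, Fin.mk_one, Fin.reduceFinMk, Matrix.cons_val,
           Set.mem_insert_iff, Set.mem_singleton_iff, Set.mem_ofPred_eq] at hv hv'
         have e1 := hap 0 (i y')
         have e2 := hap l (i y')
         have e3 := hap l (i y)
         have e4 := hca 0
         have e5 := hca l
         have e6 := hcp (i y)
         rcases hv with rfl | rfl <;> rcases hv' with h | h <;> simp_all)
  have hcross : ∀ k x' y y', y ≠ y' → (∀ v ∈ T x' y', cen s(a k, p (i y)) ≠ v) →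
      Disjoint ({a k, p (i y)} : Set V) (T x' y') →
      Disjoint (D.region {a k, p (i y)}) (D.region (T x' y')) := by
    intro k x' y y' hyy hc hdj
    by_contra hcon
    obtain ⟨u, hu, v, hv, u', hu', v', hv', huv, hX⟩ := D.region_meet _ _ hdj hcon
    have he : s(u, v) = s(a k, p (i y)) := by
      simp only [Set.mem_insert_iff, Set.mem_singleton_iff] at hu hv
      rcases hu with rfl | rfl <;> rcases hv with rfl | rfl
      · exact absurd rfl huv.ne
      · rfl
      · exact Sym2.eq_swap
      · exact absurd rfl huv.ne
    rw [he] at hX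
    have := hcen _ (hadj k (i y)) _ hX
    rcases Sym2.mem_iff.1 this with h | h
    · exact hc _ hu' h
    · exact hc _ hv' h
  have hreg : ∀ x x' y y', x < x' → y ≠ y' →
      Disjoint (D.region (T x y)) (D.region (T x' y')) := by
    intro x x' y y' hxx hyy
    have hd := hdis x x' y y' hxx hyy
    obtain ⟨hne, hf, hg⟩ := hi y y' hyy
    have hx : x = 0 ∧ x' = 1 ∨ x = 0 ∧ x' = 2 ∨ x = 1 ∧ x' = 2 := by
      clear hd; revert x x'; decide
    rcases hx with ⟨rfl, rfl⟩ | ⟨rfl, rfl⟩ | ⟨rfl, rfl⟩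
    · refine hcross 0 1 y y' hyy ?_ hd
      rintro v (rfl | rfl)
      · exact hSl _ (hiS y)
      · exact hf
    · refine hcross 0 2 y y' hyy ?_ hd
      rintro v (rfl | hv) h
      · exact hf h
      · rw [← h] at hv; exact hj _ _ hv
    · refine hcross l 2 y y' hyy ?_ hd
      rintro v (rfl | hv) h
      · exact hg h
      · rw [← h] at hv; exact hj _ _ hv
  refine k33_joined (fun x => D.pos (A x)) (fun y => D.pos (p (i y)))
    (fun x y => D.region (T x y)) ?_ ?_
  · intro x y
    have hedge : ∀ k, JoinedIn (D.region {a k, p (i y)}) (D.pos (a k)) (D.pos (p (i y))) := by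
      intro k
      refine D.joinedIn_walk _ (SimpleGraph.Walk.cons (hadj k (i y)) SimpleGraph.Walk.nil) ?_
      simp
    have hx : x = 0 ∨ x = 1 ∨ x = 2 := by revert x; decide
    rcases hx with rfl | rfl | rfl
    · exact hedge 0
    · exact hedge l
    · obtain ⟨w, hw⟩ := hw (i y) j
      exact (D.joinedIn_walk (T 2 y) w hw).symm
  · intro x y x' y' hxx hyy
    rcases lt_or_gt_of_ne hxx with h | h
    · exact hreg x x' y y' h hyy
    · exact (hreg x' x y' y h hyy.symm).symm

/-- Vertices of the hard graph: three hubs, forty clones, and isolated future apices. -/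
abbrev HardV : Type := Fin 3 ⊕ Fin 40 ⊕ Fin 121

/-- The hard graph `K_{3,40}` plus isolated vertices. -/
def hardG : SimpleGraph HardV where
  Adj x y := ∃ (k : Fin 3) (i : Fin 40), (x = Sum.inl k ∧ y = Sum.inr (Sum.inl i)) ∨
    (y = Sum.inl k ∧ x = Sum.inr (Sum.inl i))
  symm := ⟨fun _ _ ⟨k, i, h⟩ => ⟨k, i, h.symm⟩⟩
  loopless := ⟨by
    rintro x ⟨k, i, ⟨rfl, h⟩ | ⟨rfl, h⟩⟩ <;> simp at h⟩

/-- The edge between hub `k` and clone `i`. -/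
def hardE (k : Fin 3) (i : Fin 40) : Sym2 HardV := s(Sum.inl k, Sum.inr (Sum.inl i))

theorem hardE_inj {k l : Fin 3} {i j : Fin 40} (h : hardE k i = hardE l j) : k = l ∧ i = j := by
  simpa [hardE] using h

theorem hardE_mem (k : Fin 3) (i : Fin 40) : hardE k i ∈ hardG.edgeSet :=
  ⟨k, i, Or.inl ⟨rfl, rfl⟩⟩

theorem exists_hardE {e : Sym2 HardV} (he : e ∈ hardG.edgeSet) : ∃ k i, e = hardE k i := by
  induction e using Sym2.ind with
  | _ x y =>
    obtain ⟨k, i, ⟨rfl, rfl⟩ | ⟨rfl, rfl⟩⟩ := he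
    · exact ⟨k, i, rfl⟩
    · exact ⟨k, i, Sym2.eq_swap⟩

/-- Heights of the hubs. -/
def hubH : Fin 3 → ℝ := ![1, 2, -1]

theorem hubH_ne (k : Fin 3) : hubH k ≠ 0 := by
  fin_cases k <;> norm_num [hubH]

theorem hubH_inj : Function.Injective hubH := by
  intro k l h
  fin_cases k <;> fin_cases l <;> first | rfl | (norm_num [hubH] at h)

/-- Positions of the vertices. -/
noncomputable def hardPos : HardV → Plane
  | Sum.inl k => (0, hubH k)
  | Sum.inr (Sum.inl i) => ((i : ℝ) + 1, 0)
  | Sum.inr (Sum.inr j) => (-((j : ℝ) + 1), 0)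

open Classical in
/-- Straight-line edges. -/
noncomputable def hardCurve (e : Sym2 HardV) (s : ℝ) : Plane :=
  if h : ∃ q : Fin 3 × Fin 40, e = hardE q.1 q.2 then
    (s * ((h.choose.2 : ℝ) + 1), (1 - s) * hubH h.choose.1) else 0

theorem hardCurve_eq (k : Fin 3) (i : Fin 40) (s : ℝ) :
    hardCurve (hardE k i) s = (s * ((i : ℝ) + 1), (1 - s) * hubH k) := by
  have h : ∃ q : Fin 3 × Fin 40, hardE k i = hardE q.1 q.2 := ⟨(k, i), rfl⟩
  obtain ⟨h1, h2⟩ := hardE_inj h.choose_spec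
  unfold hardCurve
  rw [dif_pos h, ← h1, ← h2]

theorem clone_pos (i : Fin 40) : (0 : ℝ) < (i : ℝ) + 1 := by positivity

theorem clone_inj {i j : Fin 40} (h : (i : ℝ) + 1 = (j : ℝ) + 1) : i = j := by
  apply Fin.ext
  exact_mod_cast add_right_cancel h

/-- Common points of two edges with the same hub. -/
theorem hard_same_hub {k : Fin 3} {i j : Fin 40} (hij : i ≠ j) {s t : ℝ}
    (h : hardCurve (hardE k i) s = hardCurve (hardE k j) t) : s = 0 ∧ t = 0 := by
  rw [hardCurve_eq, hardCurve_eq, Prod.mk.injEq] at h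
  have hst : s = t := by
    have := mul_right_cancel₀ (hubH_ne k) h.2
    linarith
  subst hst
  by_cases hs : s = 0
  · exact ⟨hs, hs⟩
  · exact absurd (clone_inj (mul_left_cancel₀ hs h.1)) hij

/-- Common points of two edges with the same clone. -/
theorem hard_same_clone {k l : Fin 3} {i : Fin 40} (hkl : k ≠ l) {s t : ℝ}
    (h : hardCurve (hardE k i) s = hardCurve (hardE l i) t) : s = 1 ∧ t = 1 := by
  rw [hardCurve_eq, hardCurve_eq, Prod.mk.injEq] at h
  have hst : s = t := mul_right_cancel₀ (clone_pos i).ne' h.1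
  subst hst
  by_cases hs : 1 - s = 0
  · constructor <;> linarith
  · exact absurd (hubH_inj (mul_left_cancel₀ hs h.2)) hkl

/-- Two edges with different hubs meet at most once. -/
theorem hard_meet_unique {k l : Fin 3} {i j : Fin 40} (hkl : k ≠ l) {s t s' t' : ℝ}
    (h : hardCurve (hardE k i) s = hardCurve (hardE l j) t)
    (h' : hardCurve (hardE k i) s' = hardCurve (hardE l j) t') : s = s' := by
  rw [hardCurve_eq, hardCurve_eq, Prod.mk.injEq] at h h'
  have hi := clone_pos i
  have hj := clone_pos j
  generalize (i : ℝ) + 1 = x at *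
  generalize (j : ℝ) + 1 = y at *
  have hh : hubH k - hubH l ≠ 0 := sub_ne_zero.2 fun h => hkl (hubH_inj h)
  generalize hubH k = u at *
  generalize hubH l = v at *
  obtain ⟨h1, h2⟩ := h
  obtain ⟨h3, h4⟩ := h'
  by_contra hne
  have hd : s - s' ≠ 0 := sub_ne_zero.2 hne
  -- the determinant vanishes
  have hdet : (s - s') * (x * v - y * u) = 0 := by
    linear_combination v * (h1 - h3) + y * (h2 - h4)
  have hdet' : x * v - y * u = 0 := (mul_eq_zero.1 hdet).resolve_left hd
  have : y * (u - v) = 0 := by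
    linear_combination y * h2 + v * h1 - s * hdet'
  exact (mul_ne_zero hj.ne' hh) this

/-- The straight-line drawing. -/
noncomputable def hardDrawing : Drawing hardG where
  pos := hardPos
  curve := hardCurve
  pos_inj := by
    rintro (k | i | j) (k' | i' | j') h
    · simp only [hardPos, Prod.mk.injEq, true_and] at h
      rw [hubH_inj h]
    · simp only [hardPos, Prod.mk.injEq] at h
      exact absurd h.2 (hubH_ne _)
    · simp only [hardPos, Prod.mk.injEq] at h
      exact absurd h.2 (hubH_ne _)
    · simp only [hardPos, Prod.mk.injEq] at h
      exact absurd h.2.symm (hubH_ne _)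
    · simp only [hardPos, Prod.mk.injEq, and_true] at h
      rw [clone_inj h]
    · simp only [hardPos, Prod.mk.injEq, and_true] at h
      have h1 := clone_pos i
      have h2 : (0 : ℝ) ≤ (j' : ℝ) := by positivity
      linarith
    · simp only [hardPos, Prod.mk.injEq] at h
      exact absurd h.2.symm (hubH_ne _)
    · simp only [hardPos, Prod.mk.injEq, and_true] at h
      have h1 := clone_pos i'
      have h2 : (0 : ℝ) ≤ (j : ℝ) := by positivity
      linarith
    · simp only [hardPos, Prod.mk.injEq, and_true] at h
      have h1 : (j : ℝ) = (j' : ℝ) := by linarith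
      have h2 : j = j' := Fin.ext (by exact_mod_cast h1)
      rw [h2]
  curve_cont := by
    intro e he
    obtain ⟨k, i, rfl⟩ := exists_hardE he
    have : hardCurve (hardE k i) = fun s => (s * ((i : ℝ) + 1), (1 - s) * hubH k) :=
      funext fun s => hardCurve_eq k i s
    rw [this]
    fun_prop
  curve_inj := by
    intro e he s _ t _ h
    obtain ⟨k, i, rfl⟩ := exists_hardE he
    rw [hardCurve_eq, hardCurve_eq, Prod.mk.injEq] at h
    exact mul_right_cancel₀ (clone_pos i).ne' h.1
  curve_ends := by
    rintro x y ⟨k, i, ⟨rfl, rfl⟩ | ⟨rfl, rfl⟩⟩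
    · change ({hardCurve (hardE k i) 0, hardCurve (hardE k i) 1} : Set Plane) = _
      rw [hardCurve_eq, hardCurve_eq]
      simp [hardPos]
    · rw [Sym2.eq_swap]
      change ({hardCurve (hardE k i) 0, hardCurve (hardE k i) 1} : Set Plane) = _
      rw [hardCurve_eq, hardCurve_eq, Set.pair_comm]
      simp [hardPos]
  no_vertex_interior := by
    intro e he s hs x h
    obtain ⟨k, i, rfl⟩ := exists_hardE he
    rw [hardCurve_eq] at h
    have h1 : s * ((i : ℝ) + 1) ≠ 0 := mul_ne_zero hs.1.ne' (clone_pos i).ne'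
    have h2 : (1 - s) * hubH k ≠ 0 := mul_ne_zero (by linarith [hs.2]) (hubH_ne k)
    rcases x with k' | i' | j' <;> simp only [hardPos, Prod.mk.injEq] at h
    · exact h1 h.1
    · exact h2 h.2
    · exact h2 h.2
  finite_meets := by
    intro e he f hf hef
    obtain ⟨k, i, rfl⟩ := exists_hardE he
    obtain ⟨l, j, rfl⟩ := exists_hardE hf
    apply Set.Subsingleton.finite
    rintro _ ⟨⟨s, _, rfl⟩, ⟨t, _, h⟩⟩ _ ⟨⟨s', _, rfl⟩, ⟨t', _, h'⟩⟩
    by_cases hkl : k = l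
    · subst hkl
      have hij : i ≠ j := fun h => hef (by rw [h])
      rw [(hard_same_hub hij h.symm).1, (hard_same_hub hij h'.symm).1]
    · rw [hard_meet_unique hkl h.symm h'.symm]
  shared_endpoint := by
    intro e he f hf hef x hxe hxf
    obtain ⟨k, i, rfl⟩ := exists_hardE he
    obtain ⟨l, j, rfl⟩ := exists_hardE hf
    rintro _ ⟨⟨s, _, rfl⟩, ⟨t, _, h⟩⟩
    rw [Set.mem_singleton_iff]
    rcases Sym2.mem_iff.1 hxe with rfl | rfl <;> rcases Sym2.mem_iff.1 hxf with h1 | h1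
    · obtain rfl : k = l := Sum.inl.inj h1
      have hij : i ≠ j := fun h => hef (by rw [h])
      rw [(hard_same_hub hij h.symm).1, hardCurve_eq]
      simp [hardPos]
    · exact absurd h1 (by simp)
    · exact absurd h1 (by simp)
    · obtain rfl : i = j := Sum.inl.inj (Sum.inr.inj h1)
      have hkl : k ≠ l := fun h => hef (by rw [h])
      rw [(hard_same_clone hkl h.symm).1, hardCurve_eq]
      simp [hardPos]

theorem hardDrawing_crosses {k : Fin 3} {i : Fin 40} {f : Sym2 HardV}
    (h : hardDrawing.Crosses (hardE k i) f) :
    ∃ l j, f = hardE l j ∧ k ≠ l ∧ 0 < hubH k * hubH l := by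
  obtain ⟨q, _, hf, hne, ⟨s, hs, h1⟩, ⟨t, ht, h2⟩⟩ := h
  obtain ⟨l, j, rfl⟩ := exists_hardE hf
  have hst : hardCurve (hardE k i) s = hardCurve (hardE l j) t := h1.trans h2.symm
  refine ⟨l, j, rfl, ?_, ?_⟩
  · rintro rfl
    have hij : i ≠ j := fun h => hne (by rw [h])
    exact hs.1.ne' (hard_same_hub hij hst).1
  · rw [hardCurve_eq, hardCurve_eq, Prod.mk.injEq] at hst
    have hs1 : 0 < 1 - s := by linarith [hs.2]
    have ht1 : 0 < 1 - t := by linarith [ht.2]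
    have h3 : (1 - s) * (hubH k * hubH l) = (1 - t) * (hubH l) ^ 2 := by
      linear_combination hubH l * hst.2
    have h4 : 0 < (1 - t) * (hubH l) ^ 2 :=
      mul_pos ht1 (by have := hubH_ne l; positivity)
    rw [← h3] at h4
    exact pos_of_mul_pos_right h4 hs1.le

theorem hardG_fanPlanar : IsFanPlanarGraph hardG := by
  refine ⟨hardDrawing, ?_⟩
  intro e he _
  obtain ⟨k, i, rfl⟩ := exists_hardE he
  refine ⟨Sum.inl (if k = 0 then 1 else 0), ?_⟩
  intro f hf
  obtain ⟨l, j, rfl, hkl, hpos⟩ := hardDrawing_crosses hf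
  have : (if k = 0 then (1 : Fin 3) else 0) = l := by
    fin_cases k <;> fin_cases l <;> simp [hubH] at hkl hpos ⊢ <;> norm_num at hpos
  rw [this]
  exact Sym2.mem_mk_left _ _

/-- The statement that paths for all requested pairs have been added. -/
def PathsAdded (L : List (Fin 40 × Fin 121)) : Prop :=
  ∃ (V : Type) (_ : Fintype V) (G : SimpleGraph V) (a : Fin 3 → V) (p : Fin 40 → V)
    (z : Fin 121 → V) (col : V → Option (Fin 121)),
    IsFanPlanarGraph G ∧ Function.Injective a ∧ Function.Injective p ∧
    (∀ k, col (a k) = none) ∧ (∀ i, col (p i) = none) ∧ (∀ j, col (z j) = some j) ∧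
    (∀ k i, G.Adj (a k) (p i)) ∧
    ∀ q ∈ L, ∃ w : G.Walk (p q.1) (z q.2), ∀ v ∈ w.support, v = p q.1 ∨ col v = some q.2

theorem pathsAdded_nil : PathsAdded [] := by
  refine ⟨HardV, inferInstance, hardG, Sum.inl, fun i => Sum.inr (Sum.inl i),
    fun j => Sum.inr (Sum.inr j), Sum.elim (fun _ => none) (Sum.elim (fun _ => none) some),
    hardG_fanPlanar, Sum.inl_injective, Sum.inr_injective.comp Sum.inl_injective,
    fun _ => rfl, fun _ => rfl, fun _ => rfl, fun k i => hardE_mem k i, ?_⟩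
  simp

/-- The inclusion of `G` into a path-addition. -/
def pathAddHom {V : Type*} (G : SimpleGraph V) (u v : V) (t : ℕ)
    (F : Set (Sym2 (V ⊕ Fin t))) : G →g pathAdd G u v t F where
  toFun := Sum.inl
  map_rel' := by
    intro x y h
    rw [pathAdd, SimpleGraph.fromEdgeSet_adj]
    exact ⟨Or.inl (Or.inl ⟨s(x, y), h, rfl⟩), fun he => h.ne (Sum.inl.inj he)⟩

theorem chain_walk {V : Type*} (G : SimpleGraph V) (u v : V) (t : ℕ)
    (F : Set (Sym2 (V ⊕ Fin t))) (n : ℕ) (hn : n < t + 2) :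
    ∃ w : (pathAdd G u v t F).Walk (Sum.inl u)
        (chainVertex (Sum.inl u) (Sum.inl v) (fun i : Fin t => Sum.inr i) ⟨n, hn⟩),
      ∀ x ∈ w.support, x = Sum.inl u ∨ x = Sum.inl v ∨ ∃ i, x = Sum.inr i := by
  have hcv : ∀ i, chainVertex (Sum.inl u) (Sum.inl v) (fun i : Fin t => (Sum.inr i : V ⊕ Fin t)) i
      = Sum.inl u ∨ chainVertex (Sum.inl u) (Sum.inl v) (fun i : Fin t => Sum.inr i) i
      = Sum.inl v ∨ ∃ j, chainVertex (Sum.inl u) (Sum.inl v) (fun i : Fin t => Sum.inr i) i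
      = Sum.inr j := by
    intro i
    unfold chainVertex
    split_ifs
    · exact Or.inl rfl
    · exact Or.inr (Or.inl rfl)
    · exact Or.inr (Or.inr ⟨_, rfl⟩)
  induction n with
  | zero =>
    have h0 : chainVertex (Sum.inl u) (Sum.inl v) (fun i : Fin t => (Sum.inr i : V ⊕ Fin t))
        ⟨0, hn⟩ = Sum.inl u := by simp [chainVertex]
    rw [h0]
    exact ⟨SimpleGraph.Walk.nil, by simp⟩
  | succ n ih =>
    obtain ⟨w, hw⟩ := ih (by omega)
    by_cases he : chainVertex (Sum.inl u) (Sum.inl v) (fun i : Fin t => (Sum.inr i : V ⊕ Fin t))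
        ⟨n, by omega⟩ = chainVertex (Sum.inl u) (Sum.inl v) (fun i : Fin t => Sum.inr i) ⟨n + 1, hn⟩
    · rw [← he]
      exact ⟨w, hw⟩
    · have hadj : (pathAdd G u v t F).Adj
          (chainVertex (Sum.inl u) (Sum.inl v) (fun i : Fin t => Sum.inr i) ⟨n, by omega⟩)
          (chainVertex (Sum.inl u) (Sum.inl v) (fun i : Fin t => Sum.inr i) ⟨n + 1, hn⟩) := by
        rw [pathAdd, SimpleGraph.fromEdgeSet_adj]
        exact ⟨Or.inl (Or.inr ⟨⟨n, by omega⟩, rfl⟩), he⟩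
      refine ⟨w.concat hadj, ?_⟩
      intro x hx
      rw [SimpleGraph.Walk.support_concat] at hx
      simp only [List.mem_append, List.mem_singleton] at hx
      rcases hx with hx | rfl
      · exact hw x hx
      · exact hcv _

theorem pathsAdded_cons
    (hcl : ∀ (V : Type) (iV : Fintype V) (G : SimpleGraph V), IsFanPlanarGraph G →
      ∀ u v : V, u ≠ v → ∀ t : ℕ, @Fintype.card V iV - 1 ≤ t + 1 →
        ∃ F : Set (Sym2 (V ⊕ Fin t)), ValidSupp F ∧ IsFanPlanarGraph (pathAdd G u v t F))
    (q : Fin 40 × Fin 121) (L : List (Fin 40 × Fin 121)) (h : PathsAdded L) :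
    PathsAdded (q :: L) := by
  obtain ⟨V, iV, G, a, p, z, col, hG, ha, hp, hca, hcp, hcz, hadj, hL⟩ := h
  have hne : p q.1 ≠ z q.2 := by
    intro h
    have h1 := hcp q.1
    rw [h, hcz] at h1
    simp at h1
  obtain ⟨F, -, hF⟩ := hcl V iV G hG (p q.1) (z q.2) hne (@Fintype.card V iV) (by omega)
  let φ := pathAddHom G (p q.1) (z q.2) (@Fintype.card V iV) F
  refine ⟨V ⊕ Fin (@Fintype.card V iV), inferInstance, _, fun k => Sum.inl (a k),
    fun i => Sum.inl (p i), fun j => Sum.inl (z j), Sum.elim col (fun _ => some q.2), hF,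
    Sum.inl_injective.comp ha, Sum.inl_injective.comp hp, hca, hcp, hcz,
    fun k i => φ.map_adj (hadj k i), ?_⟩
  intro r hr
  rcases List.mem_cons.1 hr with rfl | hr
  · have hcw := chain_walk G (p r.1) (z r.2) (@Fintype.card V iV) F
      (@Fintype.card V iV + 1) (by omega)
    have hend : chainVertex (Sum.inl (p r.1)) (Sum.inl (z r.2))
        (fun i : Fin (@Fintype.card V iV) => (Sum.inr i : V ⊕ Fin (@Fintype.card V iV)))
        ⟨@Fintype.card V iV + 1, by omega⟩ = Sum.inl (z r.2) := by
      simp [chainVertex]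
    rw [hend] at hcw
    obtain ⟨w, hw⟩ := hcw
    refine ⟨w, fun v hv => ?_⟩
    rcases hw v hv with rfl | rfl | ⟨i, rfl⟩
    · exact Or.inl rfl
    · exact Or.inr (hcz r.2)
    · exact Or.inr rfl
  · obtain ⟨w, hw⟩ := hL r hr
    have key : ∃ w' : (pathAdd G (p q.1) (z q.2) (@Fintype.card V iV) F).Walk
        (φ (p r.1)) (φ (z r.2)), ∀ v ∈ w'.support,
          v = φ (p r.1) ∨ Sum.elim col (fun _ => some q.2) v = some r.2 := by
      refine ⟨w.map φ, ?_⟩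
      intro v hv
      rw [SimpleGraph.Walk.support_map, List.mem_map] at hv
      obtain ⟨v', hv', rfl⟩ := hv
      rcases hw v' hv' with rfl | h
      · exact Or.inl rfl
      · exact Or.inr h
    exact key

/-- The class of fan-planar graphs is not closed under path-addition:
there are a fan-planar graph `G`, distinct vertices `u, v`, and a path of length at least
`|V(G)| - 1` with new internal vertices such that for every supplementary edge set the
resulting graph is not fan-planar. -/
theorem fanPlanar_not_closedUnderPathAddition :
    ∃ (V : Type) (iV : Fintype V) (G : SimpleGraph V),
      IsFanPlanarGraph G ∧
      ∃ u v : V, u ≠ v ∧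
        ∃ t : ℕ, @Fintype.card V iV - 1 ≤ t + 1 ∧
          ∀ F : Set (Sym2 (V ⊕ Fin t)), ValidSupp F →
            ¬ IsFanPlanarGraph (pathAdd G u v t F) := by
  by_contra hcon
  push Not at hcon
  have hcl : ∀ (V : Type) (iV : Fintype V) (G : SimpleGraph V), IsFanPlanarGraph G →
      ∀ u v : V, u ≠ v → ∀ t : ℕ, @Fintype.card V iV - 1 ≤ t + 1 →
        ∃ F : Set (Sym2 (V ⊕ Fin t)), ValidSupp F ∧ IsFanPlanarGraph (pathAdd G u v t F) :=
    fun V iV G hG u v huv t ht => hcon V iV G hG u v huv t ht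
  have hall : ∀ L, PathsAdded L := by
    intro L
    induction L with
    | nil => exact pathsAdded_nil
    | cons q L ih => exact pathsAdded_cons hcl q L ih
  obtain ⟨V, _, G, a, p, z, col, hG, ha, hp, hca, hcp, -, hadj, hL⟩ :=
    hall (Finset.univ : Finset (Fin 40 × Fin 121)).toList
  exact core_not_fanPlanar G a p z col ha hp hca hcp hadj
    (fun i j => hL (i, j) (by simp)) hG
end

section
/- The class of 4-map graphs is not closed under path-addition: there exist a 4-map graph G, distinct vertices u, v of G, and a path P of length at least |V(G)|−1 from u to v whose internal vertices are new, such that for every supplementary edge set F the graph G ⊕ P ⊕ F is not a 4-map graph. -/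
/-- A closed topological disk in the plane: a continuous injective image of the closed
unit disk. -/
def IsClosedDisk (R : Set Plane) : Prop :=
  ∃ f : Plane → Plane,
    ContinuousOn f (Metric.closedBall 0 1) ∧
    Set.InjOn f (Metric.closedBall 0 1) ∧
    f '' Metric.closedBall 0 1 = R

/-- `G` is a `k`-map graph: there is a map — a finite family of closed topological disks
(regions) with pairwise disjoint interiors, no point of the plane belonging to more than
`k` regions — whose regions are the vertices of `G`, two distinct regions being adjacent
if and only if their boundaries share at least one point. -/
def IsKMapGraph {V : Type*} (G : SimpleGraph V) (k : ℕ) : Prop :=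
  ∃ R : V → Set Plane,
    (∀ x : V, IsClosedDisk (R x)) ∧
    (Pairwise fun x y : V => Disjoint (interior (R x)) (interior (R y))) ∧
    (∀ x y : V, x ≠ y → (G.Adj x y ↔ (R x ∩ R y).Nonempty)) ∧
    (∀ p : Plane, {x : V | p ∈ R x}.ncard ≤ k)



/-! ### Continuous logarithms and winding -/

theorem exists_clog {A : Type*} [TopologicalSpace A] [SimplyConnectedSpace A]
    [LocallyPathConnectedSpace A] (f : A → ℂ) (hf : Continuous f) (h0 : ∀ a, f a ≠ 0) :
    ∃ L : A → ℂ, Continuous L ∧ ∀ a, Complex.exp (L a) = f a := by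
  obtain ⟨a₀⟩ : Nonempty A := inferInstance
  let f' : C(A, {z : ℂ // z ≠ 0}) := ⟨fun a => ⟨f a, h0 a⟩, by fun_prop⟩
  obtain ⟨F, ⟨_, hF⟩, _⟩ := Complex.isCoveringMap_exp.existsUnique_continuousMap_lifts f' a₀
    (Complex.log (f a₀)) (Subtype.ext (Complex.exp_log (h0 a₀)))
  exact ⟨F, F.continuous, fun a => congrArg Subtype.val (congrFun hF a)⟩

theorem clog_unique {A : Type*} [TopologicalSpace A] [PreconnectedSpace A]
    {L L' : A → ℂ} (hL : Continuous L) (hL' : Continuous L') (c : ℂ)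
    (h : ∀ a, Complex.exp (L a) = c * Complex.exp (L' a)) (a b : A) :
    L a - L' a = L b - L' b := by
  have hc : Complex.exp (L b - L' b) = c := by
    rw [Complex.exp_sub, h b]; field_simp [Complex.exp_ne_zero]
  have := Complex.isCoveringMap_exp.eq_of_comp_eq (g₁ := L) (g₂ := fun a => L' a + (L b - L' b))
    hL (by fun_prop) (by
      funext x
      apply Subtype.ext
      simp only [Function.comp]
      rw [h x, Complex.exp_add, hc, mul_comm]) b (by ring)
  have := congrFun this a
  rw [this]; ring

/-- `w` is the variation over `[0,1]` of a continuous logarithm of `f`. -/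
def HasVar (f : ℝ → ℂ) (w : ℂ) : Prop :=
  ∃ L : ℝ → ℂ, Continuous L ∧ (∀ s, Complex.exp (L s) = f s) ∧ w = L 1 - L 0

theorem HasVar.exists {f : ℝ → ℂ} (hf : Continuous f) (h0 : ∀ a, f a ≠ 0) : ∃ w, HasVar f w := by
  obtain ⟨L, h1, h2⟩ := exists_clog f hf h0
  exact ⟨_, L, h1, h2, rfl⟩

theorem HasVar.unique_mul {f g : ℝ → ℂ} {w w' : ℂ} (hf : HasVar f w) (hg : HasVar g w') (c : ℂ)
    (h : ∀ s, f s = c * g s) : w = w' := by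
  obtain ⟨L, h1, h2, rfl⟩ := hf
  obtain ⟨L', h1', h2', rfl⟩ := hg
  have := clog_unique h1 h1' c (fun a => by rw [h2, h2', h]) 1 0
  linear_combination this

theorem HasVar.unique {f : ℝ → ℂ} {w w' : ℂ} (hf : HasVar f w) (hg : HasVar f w') : w = w' :=
  hf.unique_mul hg 1 (by simp)

theorem HasVar.unique_neg {f g : ℝ → ℂ} {w w' : ℂ} (hf : HasVar f w) (hg : HasVar g w')
    (h : ∀ s, f s = - g s) : w = w' :=
  hf.unique_mul hg (-1) (by simpa using h)

theorem HasVar.exp {f : ℝ → ℂ} {w : ℂ} (hf : HasVar f w) : Complex.exp w * f 0 = f 1 := by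
  obtain ⟨L, h1, h2, rfl⟩ := hf
  rw [← h2, ← h2, ← Complex.exp_add]; congr 1; ring

theorem HasVar.rect {F : ℝ × ℝ → ℂ} (hF : Continuous F) (h0 : ∀ a, F a ≠ 0) {w1 w2 w3 w4 : ℂ}
    (h1 : HasVar (fun s => F (s, 0)) w1) (h2 : HasVar (fun s => F (s, 1)) w2)
    (h3 : HasVar (fun s => F (0, s)) w3) (h4 : HasVar (fun s => F (1, s)) w4) :
    w1 + w4 = w3 + w2 := by
  obtain ⟨L, hL, hL'⟩ := exists_clog F hF h0
  rw [h1.unique ⟨fun s => L (s, 0), by fun_prop, fun s => hL' _, rfl⟩,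
    h2.unique ⟨fun s => L (s, 1), by fun_prop, fun s => hL' _, rfl⟩,
    h3.unique ⟨fun s => L (0, s), by fun_prop, fun s => hL' _, rfl⟩,
    h4.unique ⟨fun s => L (1, s), by fun_prop, fun s => hL' _, rfl⟩]
  ring

theorem HasVar.loop {F : ℝ × ℝ → ℂ} (hF : Continuous F) (h0 : ∀ a, F a ≠ 0) {w w' : ℂ}
    (hp : ∀ s, F (s, 1) = F (s, 0))
    (h3 : HasVar (fun s => F (0, s)) w) (h4 : HasVar (fun s => F (1, s)) w') : w = w' := by
  obtain ⟨w1, h1⟩ := HasVar.exists (f := fun s => F (s, 0)) (by fun_prop) (fun _ => h0 _)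
  have h2 : HasVar (fun s => F (s, 1)) w1 := by simpa only [hp] using h1
  have := HasVar.rect hF h0 h1 h2 h3 h4
  linear_combination -this

theorem HasVar.odd {f : ℝ → ℂ} {w : ℂ} (h : HasVar f w) (ho : ∀ s, f (s + 1/2) = - f s) :
    w ≠ 0 := by
  obtain ⟨L, h1, h2, rfl⟩ := h
  have := clog_unique (L := fun s => L (s + 1/2)) (L' := L) (by fun_prop) h1 (-1)
    (fun a => by rw [h2, h2, ho]; ring) 0 (1/2)
  intro hw
  norm_num at this
  have h3 : L (1/2) = L 0 := by linear_combination (1/2) * this + (1/2) * hw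
  have h4 : f (1/2) = f 0 := by rw [← h2, ← h2, h3]
  have h5 := ho 0
  rw [zero_add, h4] at h5
  have h6 : f 0 ≠ 0 := by rw [← h2]; exact Complex.exp_ne_zero _
  apply h6
  linear_combination (1/2) * h5

theorem HasVar.const {c : ℂ} (hc : c ≠ 0) : HasVar (fun _ => c) 0 :=
  ⟨fun _ => Complex.log c, by fun_prop, fun _ => Complex.exp_log hc, by simp⟩

/-! ### The van Kampen obstruction -/

theorem vanKampen_int {n : ℕ} (c : Fin n → ℂ) (E : Fin n → Fin n → Prop)
    (g : Fin n → Fin n → ℝ → ℂ)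
    (hg : ∀ i j, E i j → Continuous (g i j) ∧ g i j 0 = c i ∧ g i j 1 = c j)
    (hd : ∀ i j k l, E i j → E k l → i ≠ k → i ≠ l → j ≠ k → j ≠ l →
      ∀ s t, g i j s ≠ g k l t) :
    ∃ N : Fin n → Fin n → Fin n → ℤ, ∀ i j k l, E i j → E k l → i ≠ k → i ≠ l → j ≠ k → j ≠ l →
      2 * (N i j l - N i j k - N k l j + N k l i) =
        (if j < l then 1 else -1) - (if j < k then 1 else -1) - (if i < l then 1 else -1)
          + (if i < k then 1 else -1) := by
  classical
  let θ : Fin n → Fin n → ℂ := fun i k =>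
    if i < k then Complex.log (c i - c k) else Complex.log (c k - c i) + Real.pi * Complex.I
  have hθ : ∀ i k, c i ≠ c k → Complex.exp (θ i k) = c i - c k := by
    intro i k h
    simp only [θ]
    split_ifs
    · exact Complex.exp_log (sub_ne_zero.2 h)
    · rw [Complex.exp_add, Complex.exp_log (sub_ne_zero.2 h.symm), Complex.exp_pi_mul_I]; ring
  have hθ' : ∀ i k, i ≠ k → θ k i - θ i k = (if i < k then 1 else -1) * (Real.pi * Complex.I) := by
    intro i k h
    simp only [θ]
    rcases lt_or_gt_of_ne h with h | h
    · simp [h, h.not_gt]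
    · simp [h, h.not_gt]
  have key : ∀ i j k, ∃ m : ℤ, E i j → (∀ s, g i j s ≠ c k) →
      HasVar (fun s => g i j s - c k) (θ j k - θ i k + m * (2 * Real.pi * Complex.I)) := by
    intro i j k
    by_cases h : E i j ∧ (∀ s, g i j s ≠ c k)
    · obtain ⟨h1, h2⟩ := h
      obtain ⟨hc, e0, e1⟩ := hg i j h1
      obtain ⟨w, hw⟩ := HasVar.exists (f := fun s => g i j s - c k) (by fun_prop)
        (fun s => sub_ne_zero.2 (h2 s))
      have h3 := hw.exp
      simp only [e0, e1] at h3
      have hik : c i ≠ c k := e0 ▸ h2 0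
      have hjk : c j ≠ c k := e1 ▸ h2 1
      rw [← hθ i k hik, ← hθ j k hjk, ← Complex.exp_add] at h3
      obtain ⟨m, hm⟩ := Complex.exp_eq_exp_iff_exists_int.1 h3
      refine ⟨m, fun _ _ => ?_⟩
      have : w = θ j k - θ i k + m * (2 * Real.pi * Complex.I) := by linear_combination hm
      exact this ▸ hw
    · exact ⟨0, fun h1 h2 => absurd ⟨h1, h2⟩ h⟩
  choose N hN using key
  refine ⟨N, ?_⟩
  intro i j k l hij hkl hik hil hjk hjl
  obtain ⟨c1, e10, e11⟩ := hg i j hij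
  obtain ⟨c2, e20, e21⟩ := hg k l hkl
  have hne := hd i j k l hij hkl hik hil hjk hjl
  have a1 := hN i j k hij (fun s => e20 ▸ hne s 0)
  have a2 := hN i j l hij (fun s => e21 ▸ hne s 1)
  have a3 := hN k l i hkl (fun s => e10 ▸ (hne 0 s).symm)
  have a4 := hN k l j hkl (fun s => e11 ▸ (hne 1 s).symm)
  have cF : Continuous (fun x : ℝ × ℝ => g i j x.1 - g k l x.2) := by fun_prop
  obtain ⟨w3, h3⟩ := HasVar.exists (f := fun s => c i - g k l s) (by fun_prop)
    (fun s => sub_ne_zero.2 (e10 ▸ hne 0 s))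
  obtain ⟨w4, h4⟩ := HasVar.exists (f := fun s => c j - g k l s) (by fun_prop)
    (fun s => sub_ne_zero.2 (e11 ▸ hne 1 s))
  have b3 := h3.unique_neg a3 (fun s => by ring)
  have b4 := h4.unique_neg a4 (fun s => by ring)
  have R := HasVar.rect cF (fun x => sub_ne_zero.2 (hne x.1 x.2))
    (by simpa only [e20] using a1) (by simpa only [e21] using a2)
    (by simpa only [e10] using h3) (by simpa only [e11] using h4)
  rw [b3, b4] at R
  have t1 := hθ' j l hjl
  have t2 := hθ' j k hjk
  have t3 := hθ' i l hil
  have t4 := hθ' i k hik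
  have hpi : (Real.pi * Complex.I : ℂ) ≠ 0 := by simp [Real.pi_ne_zero]
  have : (((2 * (N i j l - N i j k - N k l j + N k l i) : ℤ)) : ℂ) * (Real.pi * Complex.I) =
      (((if j < l then 1 else -1) - (if j < k then 1 else -1) - (if i < l then 1 else -1)
          + (if i < k then 1 else -1) : ℤ) : ℂ) * (Real.pi * Complex.I) := by
    push_cast
    linear_combination -R + t1 - t2 - t3 + t4
  exact_mod_cast mul_right_cancel₀ hpi this

/-- identification of the plane with `ℂ` -/
noncomputable def toC (p : ℝ × ℝ) : ℂ := ⟨p.1, p.2⟩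

theorem toC_inj : Function.Injective toC := by
  intro p q h
  have h1 := congrArg Complex.re h
  have h2 := congrArg Complex.im h
  exact Prod.ext h1 h2

theorem toC_cont : Continuous toC :=
  Complex.equivRealProdCLM.symm.continuous

theorem vanKampen_plane {n : ℕ} (c : Fin n → ℝ × ℝ) (E : Fin n → Fin n → Prop)
    (F : Fin n → Fin n → Set (ℝ × ℝ))
    (hJ : ∀ i j, E i j → JoinedIn (F i j) (c i) (c j))
    (hd : ∀ i j k l, E i j → E k l → i < k → i ≠ l → j ≠ k → j ≠ l → Disjoint (F i j) (F k l)) :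
    ∃ N : Fin n → Fin n → Fin n → ℤ, ∀ i j k l, E i j → E k l → i ≠ k → i ≠ l → j ≠ k → j ≠ l →
      2 * (N i j l - N i j k - N k l j + N k l i) =
        (if j < l then 1 else -1) - (if j < k then 1 else -1) - (if i < l then 1 else -1)
          + (if i < k then 1 else -1) := by
  classical
  refine vanKampen_int (fun i => toC (c i)) E
    (fun i j s => if h : E i j then toC ((hJ i j h).somePath.extend s) else 0) ?_ ?_
  · intro i j h
    simp only [h, dif_pos]
    refine ⟨toC_cont.comp (Path.continuous_extend _), by simp, by simp⟩
  · intro i j k l h1 h2 hik hil hjk hjl s t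
    simp only [h1, h2, dif_pos]
    have m1 : (hJ i j h1).somePath.extend s ∈ F i j := by
      have := Set.mem_range_self (f := (hJ i j h1).somePath.extend) s
      rw [Path.extend_range] at this
      obtain ⟨x, hx⟩ := this
      rw [← hx]; exact (hJ i j h1).somePath_mem x
    have m2 : (hJ k l h2).somePath.extend t ∈ F k l := by
      have := Set.mem_range_self (f := (hJ k l h2).somePath.extend) t
      rw [Path.extend_range] at this
      obtain ⟨x, hx⟩ := this
      rw [← hx]; exact (hJ k l h2).somePath_mem x
    intro h
    have h := toC_inj h
    rcases lt_or_gt_of_ne hik with hlt | hlt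
    · exact Set.disjoint_left.1 (hd i j k l h1 h2 hlt hil hjk hjl) m1 (h ▸ m2)
    · exact Set.disjoint_left.1 (hd k l i j h2 h1 hlt hjk.symm hil.symm hjl.symm) m2 (h ▸ m1)

theorem no_K5 (c : Fin 5 → ℝ × ℝ) (F : Fin 5 → Fin 5 → Set (ℝ × ℝ))
    (hJ : ∀ i j, i < j → JoinedIn (F i j) (c i) (c j))
    (hd : ∀ i j k l, i < j → k < l → i < k → i ≠ l → j ≠ k → j ≠ l → Disjoint (F i j) (F k l)) :
    False := by
  obtain ⟨N, hN⟩ := vanKampen_plane c (fun i j => i < j) F hJ hd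
  have H : ∀ i j k l : Fin 5, i < j → k < l → i ≠ k → i ≠ l → j ≠ k → j ≠ l →
     _ := hN
  have e1 := H 0 1 2 3 (by decide) (by decide) (by decide) (by decide) (by decide) (by decide)
  have e2 := H 0 1 2 4 (by decide) (by decide) (by decide) (by decide) (by decide) (by decide)
  have e3 := H 0 1 3 4 (by decide) (by decide) (by decide) (by decide) (by decide) (by decide)
  have e4 := H 0 2 1 3 (by decide) (by decide) (by decide) (by decide) (by decide) (by decide)
  have e5 := H 0 2 1 4 (by decide) (by decide) (by decide) (by decide) (by decide) (by decide)
  have e6 := H 0 2 3 4 (by decide) (by decide) (by decide) (by decide) (by decide) (by decide)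
  have e7 := H 0 3 1 2 (by decide) (by decide) (by decide) (by decide) (by decide) (by decide)
  have e8 := H 0 3 1 4 (by decide) (by decide) (by decide) (by decide) (by decide) (by decide)
  have e9 := H 0 3 2 4 (by decide) (by decide) (by decide) (by decide) (by decide) (by decide)
  have f1 := H 0 4 1 2 (by decide) (by decide) (by decide) (by decide) (by decide) (by decide)
  have f2 := H 0 4 1 3 (by decide) (by decide) (by decide) (by decide) (by decide) (by decide)
  have f3 := H 0 4 2 3 (by decide) (by decide) (by decide) (by decide) (by decide) (by decide)
  have f4 := H 1 2 3 4 (by decide) (by decide) (by decide) (by decide) (by decide) (by decide)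
  have f5 := H 1 3 2 4 (by decide) (by decide) (by decide) (by decide) (by decide) (by decide)
  have f6 := H 1 4 2 3 (by decide) (by decide) (by decide) (by decide) (by decide) (by decide)
  simp +decide only [if_true, if_false] at e1 e2 e3 e4 e5 e6 e7 e8 e9 f1 f2 f3 f4 f5 f6
  omega

theorem no_K33 (c : Fin 6 → ℝ × ℝ) (F : Fin 6 → Fin 6 → Set (ℝ × ℝ))
    (hJ : ∀ i j, i < 3 ∧ 3 ≤ j → JoinedIn (F i j) (c i) (c j))
    (hd : ∀ i j k l, i < 3 ∧ 3 ≤ j → k < 3 ∧ 3 ≤ l → i < k → i ≠ l → j ≠ k → j ≠ l →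
      Disjoint (F i j) (F k l)) :
    False := by
  obtain ⟨N, hN⟩ := vanKampen_plane c (fun i j => i < 3 ∧ 3 ≤ j) F hJ hd
  have H : ∀ i k j l : Fin 6, i < 3 ∧ 3 ≤ j → k < 3 ∧ 3 ≤ l → i ≠ k → i ≠ l → j ≠ k → j ≠ l →
     _ := fun i k j l => hN i j k l
  have G : ∀ j l : Fin 6, 3 ≤ j → 3 ≤ l → j ≠ l → _ := fun j l h1 h2 h3 =>
    And.intro (H 0 1 j l ⟨by decide, h1⟩ ⟨by decide, h2⟩ (by decide) (by omega) (by omega) h3)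
     (And.intro (H 0 2 j l ⟨by decide, h1⟩ ⟨by decide, h2⟩ (by decide) (by omega) (by omega) h3)
      (H 1 2 j l ⟨by decide, h1⟩ ⟨by decide, h2⟩ (by decide) (by omega) (by omega) h3))
  have e1 := G 3 4 (by decide) (by decide) (by decide)
  have e2 := G 4 3 (by decide) (by decide) (by decide)
  have e3 := G 3 5 (by decide) (by decide) (by decide)
  have e4 := G 5 3 (by decide) (by decide) (by decide)
  have e5 := G 4 5 (by decide) (by decide) (by decide)
  have e6 := G 5 4 (by decide) (by decide) (by decide)
  simp +decide only [if_true, if_false] at e1 e2 e3 e4 e5 e6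
  omega

/-! ### Invariance of domain in the plane -/

/-- the loop of radius `r` around the origin -/
noncomputable def circ (r s : ℝ) : ℝ × ℝ :=
  (r * Real.cos (2 * Real.pi * s), r * Real.sin (2 * Real.pi * s))

theorem circ_cont (r : ℝ) : Continuous (circ r) := by
  unfold circ; fun_prop

theorem circ_norm (r s : ℝ) (hr : 0 ≤ r) : ‖circ r s‖ ≤ r := by
  rw [circ, Prod.norm_mk, sup_le_iff, Real.norm_eq_abs, Real.norm_eq_abs, abs_mul, abs_mul,
    abs_of_nonneg hr]
  exact ⟨mul_le_of_le_one_right hr (Real.abs_cos_le_one _),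
    mul_le_of_le_one_right hr (Real.abs_sin_le_one _)⟩

theorem circ_ne (r s : ℝ) (hr : 0 < r) : circ r s ≠ 0 := by
  intro h
  have h1 : r * Real.cos (2 * Real.pi * s) = 0 := congrArg Prod.fst h
  have h2 : r * Real.sin (2 * Real.pi * s) = 0 := congrArg Prod.snd h
  have h3 := Real.sin_sq_add_cos_sq (2 * Real.pi * s)
  have h1 := (mul_eq_zero.1 h1).resolve_left hr.ne'
  have h2 := (mul_eq_zero.1 h2).resolve_left hr.ne'
  rw [h1, h2] at h3
  norm_num at h3

theorem circ_half (r s : ℝ) : circ r (s + 1/2) = - circ r s := by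
  have : 2 * Real.pi * (s + 1/2) = 2 * Real.pi * s + Real.pi := by ring
  rw [circ, circ, this, Real.cos_add_pi, Real.sin_add_pi, Prod.neg_mk, mul_neg, mul_neg]

theorem circ_one (r : ℝ) : circ r 1 = circ r 0 := by
  simp [circ]

/-- clamping to `[0,1]` -/
noncomputable def clamp (x : ℝ) : ℝ := max 0 (min x 1)

theorem clamp_cont : Continuous clamp := by unfold clamp; fun_prop
theorem clamp_nonneg (x : ℝ) : 0 ≤ clamp x := le_max_left _ _
theorem clamp_le (x : ℝ) : clamp x ≤ 1 := max_le zero_le_one (min_le_right _ _)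
theorem clamp_zero : clamp 0 = 0 := by simp [clamp]
theorem clamp_one : clamp 1 = 1 := by simp [clamp]

theorem toC_sub_ne {p q : ℝ × ℝ} (h : p ≠ q) : toC p - toC q ≠ 0 :=
  sub_ne_zero.2 fun h' => h (toC_inj h')

theorem mem_interior_image {K : Set (ℝ × ℝ)} {f : ℝ × ℝ → ℝ × ℝ} (hf : ContinuousOn f K)
    (hi : Set.InjOn f K) {a : ℝ × ℝ} (ha : a ∈ interior K) : f a ∈ interior (f '' K) := by
  obtain ⟨r, hr, hrK⟩ : ∃ r > 0, Metric.closedBall a r ⊆ K :=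
    Metric.nhds_basis_closedBall.mem_iff.1 (mem_interior_iff_mem_nhds.1 ha)
  have hK : ∀ x : ℝ × ℝ, ‖x‖ ≤ r → a + x ∈ K := fun x hx =>
    hrK (by simpa [Metric.mem_closedBall, dist_eq_norm] using hx)
  have hKs : ∀ c s : ℝ, |c| ≤ 1 → a + c • circ r s ∈ K := by
    intro c s hc
    apply hK
    rw [norm_smul, Real.norm_eq_abs]
    calc |c| * ‖circ r s‖ ≤ 1 * r := by
          gcongr
          exact circ_norm r s hr.le
      _ = r := one_mul r
  have haK : a ∈ K := interior_subset ha
  have hcc := circ_cont r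
  have hcl := clamp_cont
  -- the map as composed with scaled circles is continuous
  have hcomp : ∀ {X : Type} [TopologicalSpace X] (c s : X → ℝ), Continuous c → Continuous s →
      (∀ x, |c x| ≤ 1) → Continuous fun x => toC (f (a + c x • circ r (s x))) := by
    intro X _ c s hc hs h1
    refine toC_cont.comp (hf.comp_continuous (by fun_prop) fun x => hKs _ _ (h1 x))
  -- the loop around f a has nonzero variation
  obtain ⟨w, hw⟩ := HasVar.exists (f := fun s => toC (f (a + circ r s)) - toC (f a))
    (by
      have := hcomp (X := ℝ) (fun _ => 1) (fun s => s) (by fun_prop) (by fun_prop) (by simp)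
      simp only [one_smul] at this
      fun_prop)
    (fun s => toC_sub_ne fun h => by
      have := hi (by simpa using hKs 1 s (by simp)) haK h
      exact circ_ne r s hr (by simpa using this))
  have hw0 : w ≠ 0 := by
    let c1 : ℝ × ℝ → ℝ := fun x => 1 / (1 + clamp x.1)
    let c2 : ℝ × ℝ → ℝ := fun x => -(clamp x.1 / (1 + clamp x.1))
    have pos : ∀ x : ℝ × ℝ, 0 < 1 + clamp x.1 := fun x => by linarith [clamp_nonneg x.1]
    have hc1 : Continuous c1 := by
      refine Continuous.div (by fun_prop) (by fun_prop) fun x => (pos x).ne'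
    have hc2 : Continuous c2 := by
      refine Continuous.neg (Continuous.div (by fun_prop) (by fun_prop) fun x => (pos x).ne')
    have b1 : ∀ x, |c1 x| ≤ 1 := fun x => by
      simp only [c1]
      rw [abs_of_pos (div_pos one_pos (pos x)), div_le_one (pos x)]
      linarith [clamp_nonneg x.1]
    have b2 : ∀ x, |c2 x| ≤ 1 := fun x => by
      simp only [c2]
      rw [abs_neg, abs_of_nonneg (div_nonneg (clamp_nonneg _) (pos x).le), div_le_one (pos x)]
      linarith
    let F : ℝ × ℝ → ℂ := fun x =>
      toC (f (a + c1 x • circ r x.2)) - toC (f (a + c2 x • circ r x.2))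
    have hF : Continuous F :=
      (hcomp c1 (fun x => x.2) hc1 (by fun_prop) b1).sub (hcomp c2 (fun x => x.2) hc2 (by fun_prop) b2)
    have hF0 : ∀ x, F x ≠ 0 := fun x => toC_sub_ne fun h => by
      have h1 := hi (hKs _ _ (b1 x)) (hKs _ _ (b2 x)) h
      have h2 : (c1 x - c2 x) • circ r x.2 = 0 := by
        rw [sub_smul, sub_eq_zero]; exact add_left_cancel h1
      have h3 : c1 x - c2 x = 1 := by
        simp only [c1, c2]; field_simp [(pos x).ne']; ring
      rw [h3, one_smul] at h2
      exact circ_ne r _ hr h2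
    obtain ⟨w', hw'⟩ := HasVar.exists (f := fun s => F (1, s)) (by fun_prop) (fun _ => hF0 _)
    have e : w = w' := by
      refine HasVar.loop hF hF0 (fun s => ?_) ?_ hw'
      · simp only [F, c1, c2, circ_one]
      · simpa [F, c1, c2, clamp_zero] using hw
    rw [e]
    refine hw'.odd fun s => ?_
    simp only [F, c1, c2, clamp_one, circ_half]
    rw [smul_neg, smul_neg, ← neg_smul, ← neg_smul]
    norm_num
  -- a uniform lower bound on the distance
  obtain ⟨δ, hδ, hδs⟩ : ∃ δ > 0, ∀ s ∈ Set.Icc (0:ℝ) 1,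
      δ ≤ ‖toC (f (a + circ r s)) - toC (f a)‖ := by
    have hcont : Continuous fun s => ‖toC (f (a + circ r s)) - toC (f a)‖ := by
      have := hcomp (X := ℝ) (fun _ => 1) (fun s => s) (by fun_prop) (by fun_prop) (by simp)
      simp only [one_smul] at this
      fun_prop
    obtain ⟨s0, hs0, hm⟩ := (isCompact_Icc (a := (0:ℝ)) (b := 1)).exists_isMinOn
      ⟨0, by simp⟩ hcont.continuousOn
    refine ⟨_, ?_, fun s hs => hm hs⟩
    apply norm_pos_iff.2
    refine toC_sub_ne fun h => ?_
    have := hi (by simpa using hKs 1 s0 (by simp)) haK h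
    exact circ_ne r s0 hr (by simpa using this)
  -- points near f a are in the image
  rw [mem_interior_iff_mem_nhds]
  have hU : {q : ℝ × ℝ | ‖toC q - toC (f a)‖ < δ} ∈ nhds (f a) := by
    have ho : IsOpen {q : ℝ × ℝ | ‖toC q - toC (f a)‖ < δ} :=
      isOpen_lt (by have := toC_cont; fun_prop) continuous_const
    exact ho.mem_nhds (by simpa using hδ)
  refine Filter.mem_of_superset hU ?_
  intro q hq
  by_contra hqK
  have hne : ∀ p ∈ K, toC (f p) - toC q ≠ 0 := fun p hp => toC_sub_ne fun h => hqK ⟨p, hp, h⟩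
  apply hw0
  -- first homotopy
  have hcs : Continuous fun x : ℝ × ℝ => toC (f (a + clamp x.1 • circ r x.2)) :=
    hcomp (fun x : ℝ × ℝ => clamp x.1) (fun x => x.2) (by fun_prop) (by fun_prop)
      (fun x => by rw [abs_of_nonneg (clamp_nonneg _)]; exact clamp_le _)
  have hc1 : Continuous fun s => toC (f (a + circ r s)) := by
    have := hcomp (X := ℝ) (fun _ => 1) (fun s => s) (by fun_prop) (by fun_prop) (by simp)
    simpa only [one_smul] using this
  obtain ⟨w', hw'⟩ := HasVar.exists (f := fun s => toC (f (a + circ r s)) - toC q)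
    (by fun_prop) (fun s => hne _ (by simpa using hKs 1 s (by simp)))
  have e1 : (0 : ℂ) = w' := by
    refine HasVar.loop (F := fun x => toC (f (a + clamp x.1 • circ r x.2)) - toC q)
      (by fun_prop) (fun x => hne _ (hKs _ _
        (by rw [abs_of_nonneg (clamp_nonneg _)]; exact clamp_le _))) (fun s => ?_) ?_ ?_
    · simp only [circ_one]
    · simpa [clamp_zero] using HasVar.const (hne a haK)
    · simpa [clamp_one] using hw'
  have hc2 : Continuous fun s => toC (f (a + circ r (clamp s))) := hc1.comp hcl
  obtain ⟨v1, hv1⟩ := HasVar.exists (f := fun s => toC (f (a + circ r (clamp s))) - toC (f a))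
    (by fun_prop) (fun s => by
      have := hδs (clamp s) ⟨clamp_nonneg s, clamp_le s⟩
      intro h; rw [h, norm_zero] at this; linarith)
  obtain ⟨v2, hv2⟩ := HasVar.exists (f := fun s => toC (f (a + circ r (clamp s))) - toC q)
    (by fun_prop) (fun s => hne _ (by simpa using hKs 1 (clamp s) (by simp)))
  have e2 : v1 = v2 := by
    refine HasVar.loop (F := fun x => (toC (f (a + circ r (clamp x.2))) - toC (f a))
      - (clamp x.1 : ℂ) * (toC q - toC (f a))) ?_ (fun x => ?_) (fun s => ?_) ?_ ?_
    · have : Continuous fun x : ℝ × ℝ => toC (f (a + circ r (clamp x.2))) := hc2.comp continuous_snd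
      fun_prop
    · intro h
      have h1 := hδs (clamp x.2) ⟨clamp_nonneg _, clamp_le _⟩
      rw [sub_eq_zero.1 h, norm_mul, Complex.norm_real, Real.norm_eq_abs,
        abs_of_nonneg (clamp_nonneg _)] at h1
      have h2 : ‖toC q - toC (f a)‖ < δ := hq
      have h3 := clamp_le x.1
      have h4 := clamp_nonneg x.1
      have h5 := norm_nonneg (toC q - toC (f a))
      nlinarith
    · simp only [clamp_one, clamp_zero, circ_one]
    · simpa [clamp_zero] using hv1
    · simpa [clamp_one] using hv2
  have ext : ∀ {g : ℝ → ℂ} {x y : ℂ}, Continuous g → HasVar g x → HasVar (fun s => g (clamp s)) y → x = y := by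
    rintro g x y hg ⟨L, h1, h2, rfl⟩ hy
    have := hy.unique ⟨fun s => L (clamp s), by fun_prop, fun s => h2 _, rfl⟩
    simp only [clamp_one, clamp_zero] at this
    exact this.symm
  have e3 : w = v1 := ext (by fun_prop) hw hv1
  have e4 : w' = v2 := ext (by fun_prop) hw' hv2
  rw [e3, e2, ← e4, ← e1]

/-! ### The graph and its map -/

/-- The graph: `(s, none)` are the two hubs, `(s, some i)` form a `K₆`. -/
abbrev VG : Type := Bool × Option (Fin 3)

/-- adjacency -/
def adjG : VG → VG → Bool
  | (_, none), (_, none) => false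
  | (s, none), (s', some _) => s == s'
  | (s, some _), (s', none) => s == s'
  | (s, some i), (s', some j) => !(s == s' && i == j)

/-- the graph -/
def GG : SimpleGraph VG where
  Adj x y := adjG x y = true
  symm := ⟨by decide⟩
  loopless := ⟨by decide⟩

/-- triangle given by three half-planes -/
def tri (a1 b1 c1 a2 b2 c2 a3 b3 c3 : ℝ) : Set Plane :=
  {p | a1 * p.1 + b1 * p.2 ≤ c1 ∧ a2 * p.1 + b2 * p.2 ≤ c2 ∧ a3 * p.1 + b3 * p.2 ≤ c3}

theorem tri_disk (a1 b1 c1 a2 b2 c2 a3 b3 c3 : ℝ)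
    (hb : ∀ p ∈ tri a1 b1 c1 a2 b2 c2 a3 b3 c3, |p.1| ≤ 100 ∧ |p.2| ≤ 100)
    (x y : ℝ) (h1 : a1 * x + b1 * y < c1) (h2 : a2 * x + b2 * y < c2)
    (h3 : a3 * x + b3 * y < c3) : IsClosedDisk (tri a1 b1 c1 a2 b2 c2 a3 b3 c3) := by
  have hc : Convex ℝ (tri a1 b1 c1 a2 b2 c2 a3 b3 c3) := by
    intro p hp q hq a b ha hb' hab
    obtain ⟨p1, p2, p3⟩ := hp
    obtain ⟨q1, q2, q3⟩ := hq
    have hb'' : b = 1 - a := by linarith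
    refine ⟨?_, ?_, ?_⟩ <;> simp only [Prod.fst_add, Prod.snd_add, Prod.smul_fst, Prod.smul_snd,
      smul_eq_mul]
    · have := mul_le_mul_of_nonneg_left p1 ha
      have := mul_le_mul_of_nonneg_left q1 hb'
      subst hb''; linarith
    · have := mul_le_mul_of_nonneg_left p2 ha
      have := mul_le_mul_of_nonneg_left q2 hb'
      subst hb''; linarith
    · have := mul_le_mul_of_nonneg_left p3 ha
      have := mul_le_mul_of_nonneg_left q3 hb'
      subst hb''; linarith
  have hcl0 : ∀ a b c : ℝ, IsClosed {p : Plane | a * p.1 + b * p.2 ≤ c} := fun a b c =>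
    isClosed_le (by fun_prop) (by fun_prop)
  have hop0 : ∀ a b c : ℝ, IsOpen {p : Plane | a * p.1 + b * p.2 < c} := fun a b c =>
    isOpen_lt (by fun_prop) (by fun_prop)
  have hcl : IsClosed (tri a1 b1 c1 a2 b2 c2 a3 b3 c3) :=
    (hcl0 a1 b1 c1).inter ((hcl0 a2 b2 c2).inter (hcl0 a3 b3 c3))
  have hbd : Bornology.IsBounded (tri a1 b1 c1 a2 b2 c2 a3 b3 c3) := by
    refine (Metric.isBounded_closedBall (x := (0 : Plane)) (r := 100)).subset fun p hp => ?_
    obtain ⟨h1, h2⟩ := hb p hp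
    simp [Prod.norm_def, h1, h2]
  have hne : (interior (tri a1 b1 c1 a2 b2 c2 a3 b3 c3)).Nonempty := by
    refine ⟨(x, y), mem_interior.2 ⟨{p : Plane | a1 * p.1 + b1 * p.2 < c1 ∧
      a2 * p.1 + b2 * p.2 < c2 ∧ a3 * p.1 + b3 * p.2 < c3}, fun p hp => ⟨hp.1.le, hp.2.1.le,
        hp.2.2.le⟩, ?_, ⟨h1, h2, h3⟩⟩⟩
    exact (hop0 a1 b1 c1).inter ((hop0 a2 b2 c2).inter (hop0 a3 b3 c3))
  obtain ⟨h, -, hh, -⟩ := exists_homeomorph_image_interior_closure_frontier_eq_unitBall hc hne hbd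
  refine ⟨h.symm, h.symm.continuous.continuousOn, h.symm.injective.injOn, ?_⟩
  rw [← hh, hcl.closure_eq, ← Set.image_comp]
  simp

theorem sep_interior {A B : Set Plane} (a b c : ℝ) (h0 : 0 < a * a + b * b)
    (hA : ∀ p ∈ A, a * p.1 + b * p.2 ≤ c) (hB : ∀ p ∈ B, c ≤ a * p.1 + b * p.2) :
    Disjoint (interior A) (interior B) := by
  rw [Set.disjoint_left]
  intro p hpA hpB
  have ht : Filter.Tendsto (fun s : ℝ => (p.1 + s * a, p.2 + s * b)) (nhdsWithin 0 (Set.Ioi 0))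
      (nhds p) := by
    have : Continuous (fun s : ℝ => (p.1 + s * a, p.2 + s * b)) := by fun_prop
    have := this.tendsto 0
    simp only [zero_mul, add_zero, Prod.mk.eta] at this
    exact this.mono_left nhdsWithin_le_nhds
  have h1 := ht.eventually (mem_interior_iff_mem_nhds.1 hpA)
  obtain ⟨s, hs, hs0⟩ := (h1.and self_mem_nhdsWithin).exists
  have e1 := hA _ hs
  have e2 := hB p (interior_subset hpB)
  simp only at e1
  have : 0 < s * (a * a + b * b) := mul_pos hs0 h0
  linarith

theorem sep_tri {a1 b1 c1 a2 b2 c2 a3 b3 c3 : ℝ} {B : Set Plane}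
    (h : (0 < a1 * a1 + b1 * b1 ∧ ∀ p ∈ B, c1 ≤ a1 * p.1 + b1 * p.2) ∨
      (0 < a2 * a2 + b2 * b2 ∧ ∀ p ∈ B, c2 ≤ a2 * p.1 + b2 * p.2) ∨
      (0 < a3 * a3 + b3 * b3 ∧ ∀ p ∈ B, c3 ≤ a3 * p.1 + b3 * p.2)) :
    Disjoint (interior (tri a1 b1 c1 a2 b2 c2 a3 b3 c3)) (interior B) := by
  rcases h with h | h | h
  · exact sep_interior a1 b1 c1 h.1 (fun p hp => hp.1) h.2
  · exact sep_interior a2 b2 c2 h.1 (fun p hp => hp.2.1) h.2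
  · exact sep_interior a3 b3 c3 h.1 (fun p hp => hp.2.2) h.2

/-- the eight triangles -/
def reg : VG → Set Plane
  | (false, none) => tri (-1) 1 10 1 1 10 0 (-1) (-8)
  | (false, some 0) => tri (-2) (-1) 0 1 1 6 4 1 0
  | (false, some 1) => tri 0 1 12 1 (-3) (-30) (-1) (-3) (-30)
  | (false, some 2) => tri 2 (-1) 0 (-4) 1 0 (-1) 1 6
  | (true, none) => tri (-2) (-3) (-54) 0 1 30 2 (-3) (-54)
  | (true, some 0) => tri 2 1 0 3 2 6 (-5) (-3) 0
  | (true, some 1) => tri 0 (-1) (-12) 1 1 18 (-1) 1 18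
  | (true, some 2) => tri (-2) 1 0 (-3) 2 6 5 (-3) 0

theorem forallVG {P : VG → Prop} (h1 : P (false, none)) (h2 : P (false, some 0))
    (h3 : P (false, some 1)) (h4 : P (false, some 2)) (h5 : P (true, none))
    (h6 : P (true, some 0)) (h7 : P (true, some 1)) (h8 : P (true, some 2)) : ∀ x, P x := by
  rintro ⟨_ | _, _ | i⟩
  · exact h1
  · fin_cases i <;> assumption
  · exact h5
  · fin_cases i <;> assumption

theorem reg_disk : ∀ x, IsClosedDisk (reg x) := by
  apply forallVG
  · exact tri_disk _ _ _ _ _ _ _ _ _ (fun p ⟨h1, h2, h3⟩ => ⟨abs_le.2 ⟨by linarith, by linarith⟩, abs_le.2 ⟨by linarith, by linarith⟩⟩)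
      (0) (26/3) (by norm_num) (by norm_num) (by norm_num)
  · exact tri_disk _ _ _ _ _ _ _ _ _ (fun p ⟨h1, h2, h3⟩ => ⟨abs_le.2 ⟨by linarith, by linarith⟩, abs_le.2 ⟨by linarith, by linarith⟩⟩)
      (-8/3) (20/3) (by norm_num) (by norm_num) (by norm_num)
  · exact tri_disk _ _ _ _ _ _ _ _ _ (fun p ⟨h1, h2, h3⟩ => ⟨abs_le.2 ⟨by linarith, by linarith⟩, abs_le.2 ⟨by linarith, by linarith⟩⟩)
      (0) (34/3) (by norm_num) (by norm_num) (by norm_num)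
  · exact tri_disk _ _ _ _ _ _ _ _ _ (fun p ⟨h1, h2, h3⟩ => ⟨abs_le.2 ⟨by linarith, by linarith⟩, abs_le.2 ⟨by linarith, by linarith⟩⟩)
      (8/3) (20/3) (by norm_num) (by norm_num) (by norm_num)
  · exact tri_disk _ _ _ _ _ _ _ _ _ (fun p ⟨h1, h2, h3⟩ => ⟨abs_le.2 ⟨by linarith, by linarith⟩, abs_le.2 ⟨by linarith, by linarith⟩⟩)
      (0) (26) (by norm_num) (by norm_num) (by norm_num)
  · exact tri_disk _ _ _ _ _ _ _ _ _ (fun p ⟨h1, h2, h3⟩ => ⟨abs_le.2 ⟨by linarith, by linarith⟩, abs_le.2 ⟨by linarith, by linarith⟩⟩)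
      (-8) (14) (by norm_num) (by norm_num) (by norm_num)
  · exact tri_disk _ _ _ _ _ _ _ _ _ (fun p ⟨h1, h2, h3⟩ => ⟨abs_le.2 ⟨by linarith, by linarith⟩, abs_le.2 ⟨by linarith, by linarith⟩⟩)
      (0) (14) (by norm_num) (by norm_num) (by norm_num)
  · exact tri_disk _ _ _ _ _ _ _ _ _ (fun p ⟨h1, h2, h3⟩ => ⟨abs_le.2 ⟨by linarith, by linarith⟩, abs_le.2 ⟨by linarith, by linarith⟩⟩)
      (8) (14) (by norm_num) (by norm_num) (by norm_num)

theorem reg_interior : ∀ x y, x ≠ y → Disjoint (interior (reg x)) (interior (reg y)) := by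
  apply forallVG <;> apply forallVG <;> intro hne <;>
  first
  | exact absurd rfl hne
  | (refine sep_tri (Or.inl ⟨?_, ?_⟩)
     · norm_num
     · rintro p ⟨h1, h2, h3⟩; linarith)
  | (refine sep_tri (Or.inr (Or.inl ⟨?_, ?_⟩))
     · norm_num
     · rintro p ⟨h1, h2, h3⟩; linarith)
  | (refine sep_tri (Or.inr (Or.inr ⟨?_, ?_⟩))
     · norm_num
     · rintro p ⟨h1, h2, h3⟩; linarith)
  | (apply Disjoint.symm; refine sep_tri (Or.inl ⟨?_, ?_⟩)
     · norm_num
     · rintro p ⟨h1, h2, h3⟩; linarith)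
  | (apply Disjoint.symm; refine sep_tri (Or.inr (Or.inl ⟨?_, ?_⟩))
     · norm_num
     · rintro p ⟨h1, h2, h3⟩; linarith)
  | (apply Disjoint.symm; refine sep_tri (Or.inr (Or.inr ⟨?_, ?_⟩))
     · norm_num
     · rintro p ⟨h1, h2, h3⟩; linarith)

set_option maxHeartbeats 4000000 in
theorem reg_adj : ∀ x y, x ≠ y → (GG.Adj x y ↔ (reg x ∩ reg y).Nonempty) := by
  apply forallVG <;> apply forallVG <;> intro hne <;>
  first
  | exact absurd rfl hne
  | (refine iff_of_false (by unfold GG; decide) ?_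
     rintro ⟨p, ⟨h1, h2, h3⟩, ⟨h4, h5, h6⟩⟩
     linarith)
  | (refine iff_of_true (by unfold GG; decide) ?_
     first
     | (refine ⟨(0, 0), ?_⟩; norm_num [reg, tri]; done)
     | (refine ⟨(-6, 12), ?_⟩; norm_num [reg, tri]; done)
     | (refine ⟨(6, 12), ?_⟩; norm_num [reg, tri]; done)
     | (refine ⟨(-2, 8), ?_⟩; norm_num [reg, tri]; done)
     | (refine ⟨(0, 10), ?_⟩; norm_num [reg, tri]; done)
     | (refine ⟨(2, 8), ?_⟩; norm_num [reg, tri]; done)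
     | (refine ⟨(0, 18), ?_⟩; norm_num [reg, tri]; done)
     | (refine ⟨(-18, 30), ?_⟩; norm_num [reg, tri]; done)
     | (refine ⟨(18, 30), ?_⟩; norm_num [reg, tri]; done))

theorem GG_isMap : IsKMapGraph GG 4 := by
  classical
  refine ⟨reg, reg_disk, fun x y h => reg_interior x y h, reg_adj, fun p => ?_⟩
  rw [Set.ncard_eq_toFinset_card', Set.toFinset_ofPred, Finset.card_filter]
  simp only [Fintype.sum_prod_type, Fintype.sum_bool, Fintype.sum_option, Fin.sum_univ_three]
  have nadj : ∀ x y, x ≠ y → ¬ GG.Adj x y →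
      (if p ∈ reg x then 1 else 0) + (if p ∈ reg y then 1 else 0) ≤ 1 := by
    intro x y h1 h2
    rw [reg_adj x y h1] at h2
    by_cases h3 : p ∈ reg x <;> by_cases h4 : p ∈ reg y <;> simp [h3, h4]
    exact h2 ⟨p, h3, h4⟩
  have tr : ∀ s, (if p ∈ reg (s, some 0) then 1 else 0) + (if p ∈ reg (s, some 1) then 1 else 0)
      + (if p ∈ reg (s, some 2) then 1 else 0) ≤ 2 := by
    intro s
    have : ¬ (p ∈ reg (s, some 0) ∧ p ∈ reg (s, some 1) ∧ p ∈ reg (s, some 2)) := by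
      cases s
      all_goals
        rintro ⟨⟨h1, h2, h3⟩, ⟨h4, h5, h6⟩, ⟨h7, h8, h9⟩⟩
        linarith
    split_ifs <;> simp_all
  have t1 := tr false
  have t2 := tr true
  have n0 := nadj (false, none) (true, none) (by decide) (by unfold GG; decide)
  have n1 := fun i => nadj (false, none) (true, some i) (by simp) (by simp [GG, adjG])
  have n2 := fun i => nadj (true, none) (false, some i) (by simp) (by simp [GG, adjG])
  have n10 := n1 0
  have n11 := n1 1
  have n12 := n1 2
  have n20 := n2 0
  have n21 := n2 1
  have n22 := n2 2
  omega

/-! ### The combinatorial core -/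

theorem no_K5' (c0 c1 c2 c3 c4 : ℝ × ℝ) (F01 F02 F03 F04 F12 F13 F14 F23 F24 F34 : Set (ℝ × ℝ))
    (j01 : JoinedIn F01 c0 c1) (j02 : JoinedIn F02 c0 c2) (j03 : JoinedIn F03 c0 c3)
    (j04 : JoinedIn F04 c0 c4) (j12 : JoinedIn F12 c1 c2) (j13 : JoinedIn F13 c1 c3)
    (j14 : JoinedIn F14 c1 c4) (j23 : JoinedIn F23 c2 c3) (j24 : JoinedIn F24 c2 c4)
    (j34 : JoinedIn F34 c3 c4)
    (d1 : Disjoint F01 F23) (d2 : Disjoint F01 F24) (d3 : Disjoint F01 F34)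
    (d4 : Disjoint F02 F13) (d5 : Disjoint F02 F14) (d6 : Disjoint F02 F34)
    (d7 : Disjoint F03 F12) (d8 : Disjoint F03 F14) (d9 : Disjoint F03 F24)
    (d10 : Disjoint F04 F12) (d11 : Disjoint F04 F13) (d12 : Disjoint F04 F23)
    (d13 : Disjoint F12 F34) (d14 : Disjoint F13 F24) (d15 : Disjoint F14 F23) : False := by
  refine no_K5 ![c0, c1, c2, c3, c4] ![![∅, F01, F02, F03, F04], ![∅, ∅, F12, F13, F14],
    ![∅, ∅, ∅, F23, F24], ![∅, ∅, ∅, ∅, F34], ![∅, ∅, ∅, ∅, ∅]] ?_ ?_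
  · intro i j hij
    fin_cases i <;> fin_cases j <;> first | exact absurd hij (by decide) | assumption
  · intro i j k l h1 h2 h3 h4 h5 h6
    fin_cases i <;> fin_cases j <;> first | exact absurd h1 (by decide) | skip
    all_goals
      fin_cases k <;> first | exact absurd h3 (by decide) | exact absurd h5 (by decide) | skip
    all_goals
      fin_cases l <;> first
        | exact absurd h2 (by decide) | exact absurd h4 (by decide) | exact absurd h6 (by decide)
        | assumption

/-- Data extracted from a hypothetical map of the extended graph. -/
structure Sys where
  R : VG → Set Plane
  O : VG → Set Plane
  c : VG → Plane
  W : Set Plane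
  pt : VG → VG → Plane
  hOR : ∀ x, O x ⊆ R x
  hOd : ∀ x y, x ≠ y → Disjoint (O x) (R y)
  hOW : ∀ x, Disjoint (O x) W
  adj : ∀ x y, x ≠ y → (R x ∩ R y).Nonempty → GG.Adj x y
  pt_symm : ∀ x y, pt x y = pt y x
  pt_mem : ∀ x y, GG.Adj x y → pt x y ∈ R x ∩ R y
  pt_prot : ∀ x y q, GG.Adj x y → q ∈ R x → q ∈ R y → q ∉ W → pt x y ∉ W
  joined : ∀ x y, GG.Adj x y → JoinedIn (O x ∪ O y ∪ {pt x y}) (c x) (c y)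
  four : ∀ p x y z w, x ≠ y → x ≠ z → x ≠ w → y ≠ z → y ≠ w → z ≠ w →
    p ∈ R x → p ∈ R y → p ∈ R z → p ∈ R w →
      p ∉ W ∧ ∀ s, p ∈ R s → s = x ∨ s = y ∨ s = z ∨ s = w
  path : JoinedIn (O (false, none) ∪ O (true, none) ∪ W) (c (false, none)) (c (true, none))

namespace Sys

variable (S : Sys)

/-- the curve set through the contact point -/
def seg (a b : VG) : Set Plane := S.O a ∪ S.O b ∪ {S.pt a b}

/-- the set containing the path -/
def PS : Set Plane := S.O (false, none) ∪ S.O (true, none) ∪ S.W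

theorem O_disj {x y : VG} (h : x ≠ y) : Disjoint (S.O x) (S.O y) :=
  (S.hOd x y h).mono_right (S.hOR y)

theorem pt_notO {a b x : VG} (h : GG.Adj a b) (hx : x ≠ a) : S.pt a b ∉ S.O x := fun hp =>
  Set.disjoint_left.1 (S.hOd x a hx) hp (S.pt_mem a b h).1

theorem seg_disj {a b c d : VG} (h1 : GG.Adj a b) (h2 : GG.Adj c d) (hac : a ≠ c) (had : a ≠ d)
    (hbc : b ≠ c) (hbd : b ≠ d) (hne : S.pt a b ≠ S.pt c d) :
    Disjoint (S.seg a b) (S.seg c d) := by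
  rw [Set.disjoint_left]
  rintro p ((h | h) | h) ((h' | h') | h')
  · exact Set.disjoint_left.1 (S.O_disj hac) h h'
  · exact Set.disjoint_left.1 (S.O_disj had) h h'
  · rw [Set.mem_singleton_iff] at h'; subst h'; exact S.pt_notO h2 hac h
  · exact Set.disjoint_left.1 (S.O_disj hbc) h h'
  · exact Set.disjoint_left.1 (S.O_disj hbd) h h'
  · rw [Set.mem_singleton_iff] at h'; subst h'; exact S.pt_notO h2 hbc h
  · rw [Set.mem_singleton_iff] at h; subst h; exact S.pt_notO h1 hac.symm h'
  · rw [Set.mem_singleton_iff] at h; subst h; exact S.pt_notO h1 had.symm h'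
  · rw [Set.mem_singleton_iff] at h h'; exact hne (h ▸ h')

theorem PS_disj {a b : VG} (h1 : GG.Adj a b) (ha : a.2 ≠ none) (hb : b.2 ≠ none)
    (hp : S.pt a b ∉ S.W) : Disjoint S.PS (S.seg a b) := by
  have e : ∀ (s : Bool) (x : VG), x.2 ≠ none → (s, none) ≠ x := by
    rintro s x hx rfl; exact hx rfl
  rw [Set.disjoint_left]
  rintro p ((h | h) | h) ((h' | h') | h')
  · exact Set.disjoint_left.1 (S.O_disj (e _ _ ha)) h h'
  · exact Set.disjoint_left.1 (S.O_disj (e _ _ hb)) h h'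
  · rw [Set.mem_singleton_iff] at h'; subst h'; exact S.pt_notO h1 (e _ _ ha) h
  · exact Set.disjoint_left.1 (S.O_disj (e _ _ ha)) h h'
  · exact Set.disjoint_left.1 (S.O_disj (e _ _ hb)) h h'
  · rw [Set.mem_singleton_iff] at h'; subst h'; exact S.pt_notO h1 (e _ _ ha) h
  · exact Set.disjoint_left.1 (S.hOW _) h' h
  · exact Set.disjoint_left.1 (S.hOW _) h' h
  · rw [Set.mem_singleton_iff] at h'; subst h'; exact hp h

theorem not_hub {s : Bool} {j : Fin 3} {p : Plane} (h1 : p ∈ S.R (s, none))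
    (h2 : p ∈ S.R (!s, some j)) : False := by
  have := S.adj _ _ (by simp) ⟨p, h1, h2⟩
  simp [GG, adjG] at this

theorem adjH (s : Bool) (i : Fin 3) : GG.Adj (s, none) (s, some i) := by simp [GG, adjG]

theorem adjX (s : Bool) (i j : Fin 3) : GG.Adj (s, some i) (!s, some j) := by simp [GG, adjG]

theorem adjS (s : Bool) {i j : Fin 3} (h : i ≠ j) : GG.Adj (s, some i) (s, some j) := by
  simp [GG, adjG, h]

theorem adjFT (i j : Fin 3) : GG.Adj (false, some i) (true, some j) := adjX false i j

/-- hub segments avoid all segments having an end on the other side -/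
theorem hub_disj (s : Bool) (i : Fin 3) {a : VG} {j : Fin 3} (h : GG.Adj a (!s, some j))
    (ha1 : a ≠ (s, none)) (ha : a ≠ (s, some i)) :
    Disjoint (S.seg (s, none) (s, some i)) (S.seg a (!s, some j)) := by
  refine S.seg_disj (adjH s i) h ha1.symm (by simp) ha.symm (by simp) fun e => ?_
  have h1 := (S.pt_mem _ _ (adjH s i)).1
  have h2 := (S.pt_mem _ _ h).2
  rw [e] at h1
  exact S.not_hub h1 h2

theorem K5gen (i k j l : Fin 3) (hik : i ≠ k) (hjl : j ≠ l) (E : Set Plane)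
    (hE : JoinedIn E (S.c (false, some k)) (S.c (true, some j)))
    (e1 : Disjoint (S.seg (false, none) (false, some i)) E)
    (e2 : Disjoint (S.seg (true, none) (true, some l)) E)
    (e3 : Disjoint S.PS E)
    (e4 : Disjoint (S.seg (false, some i) (true, some l)) E)
    (p1 : S.pt (false, some i) (false, some k) ∉ S.W)
    (p2 : S.pt (false, some i) (true, some j) ∉ S.W)
    (p3 : S.pt (false, some i) (true, some l) ∉ S.W)
    (p4 : S.pt (false, some k) (true, some l) ∉ S.W)
    (n1 : S.pt (false, some i) (false, some k) ≠ S.pt (true, some j) (true, some l))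
    (n2 : S.pt (false, some i) (true, some j) ≠ S.pt (false, some k) (true, some l)) : False := by
  have jP : ∀ m, JoinedIn (S.PS ∪ S.seg (true, none) (true, some m)) (S.c (false, none))
      (S.c (true, some m)) := fun m =>
    (S.path.mono Set.subset_union_left).trans ((S.joined _ _ (adjH true m)).mono
      Set.subset_union_right)
  have v1 : ∀ m i k : Fin 3, i ≠ k → Disjoint (S.seg (true, none) (true, some m))
      (S.seg (false, some i) (false, some k)) := fun m i k h =>
    S.hub_disj true m (adjS false h) (by simp) (by simp)
  have v2 : ∀ m i k : Fin 3, m ≠ k → Disjoint (S.seg (true, none) (true, some m))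
      (S.seg (false, some i) (true, some k)) := fun m i k h => by
    have := S.hub_disj true m (j := i) (adjX false i k).symm (by simp) (by simp [h.symm])
    unfold seg at this ⊢
    rw [Set.union_comm (S.O (false, some i)), S.pt_symm (false, some i)]
    exact this
  have v3 : ∀ m i k : Fin 3, m ≠ i → Disjoint (S.seg (false, none) (false, some m))
      (S.seg (false, some i) (true, some k)) := fun m i k h =>
    S.hub_disj false m (adjX false i k) (by simp) (by simp [h.symm])
  have v4 : ∀ m i k : Fin 3, i ≠ k → Disjoint (S.seg (false, none) (false, some m))
      (S.seg (true, some i) (true, some k)) := fun m i k h =>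
    S.hub_disj false m (adjS true h) (by simp) (by simp)
  refine no_K5' (S.c (false, none)) (S.c (false, some i)) (S.c (false, some k))
    (S.c (true, some j)) (S.c (true, some l))
    (S.seg (false, none) (false, some i)) (S.seg (false, none) (false, some k))
    (S.PS ∪ S.seg (true, none) (true, some j)) (S.PS ∪ S.seg (true, none) (true, some l))
    (S.seg (false, some i) (false, some k)) (S.seg (false, some i) (true, some j))
    (S.seg (false, some i) (true, some l)) E (S.seg (false, some k) (true, some l))
    (S.seg (true, some j) (true, some l))
    (S.joined _ _ (adjH false i)) (S.joined _ _ (adjH false k)) (jP j) (jP l)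
    (S.joined _ _ (adjS false hik)) (S.joined _ _ (adjX false i j)) (S.joined _ _ (adjX false i l))
    hE (S.joined _ _ (adjX false k l)) (S.joined _ _ (adjS true hjl))
    e1 (v3 _ _ _ hik) (v4 _ _ _ hjl) (v3 _ _ _ hik.symm) (v3 _ _ _ hik.symm) (v4 _ _ _ hjl)
    ?_ ?_ ?_ ?_ ?_ ?_ ?_ ?_ e4
  · exact (S.PS_disj (adjS false hik) (by simp) (by simp) p1).union_left (v1 _ _ _ hik)
  · exact (S.PS_disj (adjFT i l) (by simp) (by simp) p3).union_left (v2 _ _ _ hjl)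
  · exact (S.PS_disj (adjFT k l) (by simp) (by simp) p4).union_left (v2 _ _ _ hjl)
  · exact (S.PS_disj (adjS false hik) (by simp) (by simp) p1).union_left (v1 _ _ _ hik)
  · exact (S.PS_disj (adjFT i j) (by simp) (by simp) p2).union_left (v2 _ _ _ hjl.symm)
  · exact e3.union_left e2
  · exact S.seg_disj (adjS false hik) (adjS true hjl) (by simp) (by simp) (by simp) (by simp) n1
  · exact S.seg_disj (adjFT i j) (adjFT k l) (by simp [hik]) (by simp) (by simp)
      (by simp [hjl]) n2

theorem SK5 (i k j l : Fin 3) (hik : i ≠ k) (hjl : j ≠ l)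
    (p1 : S.pt (false, some i) (false, some k) ∉ S.W)
    (p2 : S.pt (false, some i) (true, some j) ∉ S.W)
    (p3 : S.pt (false, some i) (true, some l) ∉ S.W)
    (p4 : S.pt (false, some k) (true, some l) ∉ S.W)
    (p5 : S.pt (false, some k) (true, some j) ∉ S.W) :
    S.pt (false, some i) (false, some k) = S.pt (true, some j) (true, some l) ∨
    S.pt (false, some i) (true, some j) = S.pt (false, some k) (true, some l) ∨
    S.pt (false, some i) (true, some l) = S.pt (false, some k) (true, some j) := by
  by_contra! hn
  refine S.K5gen i k j l hik hjl (S.seg (false, some k) (true, some j)) (S.joined _ _ (adjFT k j))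
    ?_ ?_ ?_ ?_ p1 p2 p3 p4 hn.1 hn.2.1
  · exact S.hub_disj false i (adjX false k j) (by simp) (by simp [hik.symm])
  · have := S.hub_disj true l (j := k) (adjX false k j).symm (by simp) (by simp [hjl])
    unfold seg at this ⊢
    rw [Set.union_comm (S.O (false, some k)), S.pt_symm (false, some k)]
    exact this
  · exact S.PS_disj (adjFT k j) (by simp) (by simp) p5
  · exact S.seg_disj (adjFT i l) (adjFT k j) (by simp [hik]) (by simp) (by simp)
      (by simp [hjl.symm]) hn.2.2

theorem K33 (s : Bool) (a b : Fin 3) (hab : a ≠ b) : ∃ i k, i ≠ k ∧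
    S.pt (s, some i) (!s, some a) = S.pt (s, some k) (!s, some b) := by
  by_contra! hn
  have hh : ∀ i k j, i ≠ k → Disjoint (S.seg (s, some i) (s, none))
      (S.seg (s, some k) (!s, some j)) := by
    intro i k j h
    have := S.hub_disj s i (j := j) (adjX s k j) (by simp) (by simp [h.symm])
    unfold seg at this ⊢
    rw [Set.union_comm (S.O (s, some i)), S.pt_symm (s, some i)]
    exact this
  have hx : ∀ i k, i ≠ k → Disjoint (S.seg (s, some i) (!s, some a))
      (S.seg (s, some k) (!s, some b)) := by
    intro i k h
    exact S.seg_disj (adjX s i a) (adjX s k b) (by simp [h]) (by simp) (by simp)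
      (by simp [hab]) (hn i k h)
  let V : Fin 6 → VG := ![(s, some 0), (s, some 1), (s, some 2), (s, none), (!s, some a),
    (!s, some b)]
  refine no_K33 (fun i => S.c (V i)) (fun i j => S.seg (V i) (V j)) ?_ ?_
  · intro i j hij
    refine S.joined _ _ ?_
    fin_cases i <;> fin_cases j <;> first
      | exact absurd hij (by decide) | exact (adjH s _).symm | exact adjX s _ _
  · intro i j k l h1 h2 h3 h4 h5 h6
    fin_cases i <;> fin_cases j <;> first | exact absurd h1 (by decide) | skip
    all_goals
      fin_cases k <;> first | exact absurd h3 (by decide) | skip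
    all_goals
      fin_cases l <;> first
        | exact absurd h2 (by decide) | exact absurd h6 (by decide)
        | exact hh _ _ _ (by decide) | exact (hh _ _ _ (by decide)).symm
        | exact hx _ _ (by decide) | exact (hx _ _ (by decide)).symm

end Sys

namespace Sys

variable (S : Sys)

/-- contact point of two `A` regions -/
abbrev aa (i k : Fin 3) : Plane := S.pt (false, some i) (false, some k)
/-- contact point of two `B` regions -/
abbrev bb (i k : Fin 3) : Plane := S.pt (true, some i) (true, some k)
/-- contact point of an `A` region and a `B` region -/
abbrev ab (i k : Fin 3) : Plane := S.pt (false, some i) (true, some k)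
/-- an `A` region -/
abbrev A (i : Fin 3) : Set Plane := S.R (false, some i)
/-- a `B` region -/
abbrev B (i : Fin 3) : Set Plane := S.R (true, some i)

theorem fourAB {p : Plane} {i k j l : Fin 3} (hik : i ≠ k) (hjl : j ≠ l) (h1 : p ∈ S.A i)
    (h2 : p ∈ S.A k) (h3 : p ∈ S.B j) (h4 : p ∈ S.B l) :
    p ∉ S.W ∧ (∀ m, p ∈ S.A m → m = i ∨ m = k) ∧ (∀ m, p ∈ S.B m → m = j ∨ m = l) := by
  obtain ⟨h, h'⟩ := S.four p (false, some i) (false, some k) (true, some j) (true, some l)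
    (by simp [hik]) (by simp) (by simp) (by simp) (by simp) (by simp [hjl]) h1 h2 h3 h4
  refine ⟨h, fun m hm => ?_, fun m hm => ?_⟩
  · simpa using h' _ hm
  · simpa using h' _ hm

theorem ab_mem (i j : Fin 3) : S.ab i j ∈ S.A i ∧ S.ab i j ∈ S.B j := S.pt_mem _ _ (adjFT i j)

theorem aa_mem {i j : Fin 3} (h : i ≠ j) : S.aa i j ∈ S.A i ∧ S.aa i j ∈ S.A j :=
  S.pt_mem _ _ (adjS false h)

theorem bb_mem {i j : Fin 3} (h : i ≠ j) : S.bb i j ∈ S.B i ∧ S.bb i j ∈ S.B j :=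
  S.pt_mem _ _ (adjS true h)

/-- a point where the four regions of the kite `S(p,q)` meet -/
def Meet (x : Plane) (p q : Fin 3) : Prop :=
  x ∉ S.W ∧ (∀ m, x ∈ S.A m ↔ m ≠ p) ∧ (∀ m, x ∈ S.B m ↔ m ≠ q)

theorem meet_of {x : Plane} {i k j l p q : Fin 3} (hik : i ≠ k) (hjl : j ≠ l) (hip : i ≠ p)
    (hkp : k ≠ p) (hjq : j ≠ q) (hlq : l ≠ q) (h1 : x ∈ S.A i)
    (h2 : x ∈ S.A k) (h3 : x ∈ S.B j) (h4 : x ∈ S.B l) : S.Meet x p q := by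
  obtain ⟨h, hA, hB⟩ := S.fourAB hik hjl h1 h2 h3 h4
  refine ⟨h, fun m => ⟨fun hm => ?_, fun hm => ?_⟩, fun m => ⟨fun hm => ?_, fun hm => ?_⟩⟩
  · rcases hA m hm with rfl | rfl <;> assumption
  · have : m = i ∨ m = k := by
      clear hA hB h1 h2 h3 h4 h hjl hjq hlq
      revert i k p m; decide
    rcases this with rfl | rfl <;> assumption
  · rcases hB m hm with rfl | rfl <;> assumption
  · have : m = j ∨ m = l := by
      clear hA hB h1 h2 h3 h4 h hik hip hkp
      revert j l q m; decide
    rcases this with rfl | rfl <;> assumption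

theorem meet_unique {x : Plane} {p q p' q' : Fin 3} (h : S.Meet x p q) (h' : S.Meet x p' q') :
    p = p' ∧ q = q' := by
  constructor
  · by_contra hne
    exact ((h.2.1 p).1 ((h'.2.1 p).2 hne)) rfl
  · by_contra hne
    exact ((h.2.2 q).1 ((h'.2.2 q).2 hne)) rfl

/-- two rungs of the kite cross -/
def D (p q : Fin 3) : Prop :=
  ∃ i k j l, i ≠ k ∧ j ≠ l ∧ i ≠ p ∧ k ≠ p ∧ j ≠ q ∧ l ≠ q ∧ S.ab i j = S.ab k l

/-- the two non-rungs cross -/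
def Al (p q : Fin 3) : Prop :=
  ∃ i k j l, i ≠ k ∧ j ≠ l ∧ i ≠ p ∧ k ≠ p ∧ j ≠ q ∧ l ≠ q ∧ S.aa i k = S.bb j l

theorem meet_D {i k j l p q : Fin 3} (hik : i ≠ k) (hjl : j ≠ l) (hip : i ≠ p)
    (hkp : k ≠ p) (hjq : j ≠ q) (hlq : l ≠ q) (h : S.ab i j = S.ab k l) :
    S.Meet (S.ab i j) p q :=
  S.meet_of hik hjl hip hkp hjq hlq (S.ab_mem i j).1 (h ▸ (S.ab_mem k l).1) (S.ab_mem i j).2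
    (h ▸ (S.ab_mem k l).2)

theorem meet_Al {i k j l p q : Fin 3} (hik : i ≠ k) (hjl : j ≠ l) (hip : i ≠ p)
    (hkp : k ≠ p) (hjq : j ≠ q) (hlq : l ≠ q) (h : S.aa i k = S.bb j l) :
    S.Meet (S.aa i k) p q :=
  S.meet_of hik hjl hip hkp hjq hlq (S.aa_mem hik).1 (S.aa_mem hik).2 (h ▸ (S.bb_mem hjl).1)
    (h ▸ (S.bb_mem hjl).2)

theorem D_meet {p q : Fin 3} (h : S.D p q) : ∃ x, S.Meet x p q := by
  obtain ⟨i, k, j, l, hik, hjl, hip, hkp, hjq, hlq, h⟩ := h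
  exact ⟨_, S.meet_D hik hjl hip hkp hjq hlq h⟩

theorem D_rung {p q i : Fin 3} (h : S.D p q) (hi : i ≠ p) : ∃ j, S.Meet (S.ab i j) p q := by
  obtain ⟨i', k, j, l, hik, hjl, hip, hkp, hjq, hlq, h⟩ := h
  have : i = i' ∨ i = k := by
    clear h hjl hjq hlq j l
    revert i k p i'; decide
  have hm := S.meet_D hik hjl hip hkp hjq hlq h
  rcases this with rfl | rfl
  · exact ⟨_, hm⟩
  · exact ⟨l, h ▸ hm⟩

theorem exists_third (a b : Fin 3) : ∃ c, c ≠ a ∧ c ≠ b := by revert a b; decide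

theorem D_col (q : Fin 3) : ∃ p, S.D p q := by
  obtain ⟨a, ha⟩ : ∃ a, a ≠ q := (exists_third q q).imp fun _ h => h.1
  obtain ⟨b, hb, hba⟩ := exists_third q a
  obtain ⟨i, k, hik, h⟩ := S.K33 false a b hba.symm
  obtain ⟨p, hp, hp'⟩ := exists_third i k
  exact ⟨p, i, k, a, b, hik, hba.symm, hp.symm, hp'.symm, ha, hb, h⟩

theorem D_row (p : Fin 3) : ∃ q, S.D p q := by
  obtain ⟨a, ha⟩ : ∃ a, a ≠ p := (exists_third p p).imp fun _ h => h.1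
  obtain ⟨b, hb, hba⟩ := exists_third p a
  obtain ⟨i, k, hik, h⟩ := S.K33 true a b hba.symm
  obtain ⟨q, hq, hq'⟩ := exists_third i k
  refine ⟨q, a, b, i, k, hba.symm, hik, ha, hb, hq.symm, hq'.symm, ?_⟩
  rw [S.pt_symm] at h
  rw [S.pt_symm (true, some k)] at h
  exact h

theorem prot_aa {i k : Fin 3} (h : i ≠ k) : S.aa i k ∉ S.W := by
  obtain ⟨p, hp, hp'⟩ := exists_third i k
  obtain ⟨q, hq⟩ := S.D_row p
  obtain ⟨x, hx⟩ := S.D_meet hq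
  exact S.pt_prot _ _ x (adjS false h) ((hx.2.1 i).2 hp.symm) ((hx.2.1 k).2 hp'.symm) hx.1

theorem prot_ab {i j p q : Fin 3} (hd : S.D p q) (h : i ≠ p) (h' : j ≠ q) : S.ab i j ∉ S.W := by
  obtain ⟨x, hx⟩ := S.D_meet hd
  exact S.pt_prot _ _ x (adjFT i j) ((hx.2.1 i).2 h) ((hx.2.2 j).2 h') hx.1

theorem PH (i : Fin 3) (f : Fin 4 → Fin 3 × Fin 3) (hf : Function.Injective f)
    (h : ∀ m, S.D (f m).1 (f m).2 ∧ i ≠ (f m).1) : False := by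
  choose g hg using fun m => S.D_rung (h m).1 (h m).2
  obtain ⟨a, b, hab, he⟩ := Fintype.exists_ne_map_eq_of_card_lt g (by simp)
  have := S.meet_unique (hg a) (he ▸ hg b)
  exact hab (hf (Prod.ext this.1 this.2))

theorem Al_unique {p q q' : Fin 3} (h : S.Al p q) (h' : S.Al p q') : q = q' := by
  obtain ⟨i, k, j, l, hik, hjl, hip, hkp, hjq, hlq, h⟩ := h
  obtain ⟨i', k', j', l', hik', hjl', hip', hkp', hjq', hlq', h'⟩ := h'
  have hm := S.meet_Al hik hjl hip hkp hjq hlq h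
  have hm' := S.meet_Al hik' hjl' hip' hkp' hjq' hlq' h'
  have : (i' = i ∧ k' = k) ∨ (i' = k ∧ k' = i) := by
    clear h h' hm hm'
    revert i k i' k' p; decide
  rcases this with ⟨rfl, rfl⟩ | ⟨rfl, rfl⟩
  · exact (S.meet_unique hm hm').2
  · rw [aa, S.pt_symm] at hm'
    exact (S.meet_unique hm hm').2

theorem Al_or_D {i k j l p q : Fin 3} (hik : i ≠ k) (hjl : j ≠ l) (hip : i ≠ p)
    (hkp : k ≠ p) (hjq : j ≠ q) (hlq : l ≠ q) (h : ∀ i j, i ≠ p → j ≠ q → S.ab i j ∉ S.W) :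
    S.aa i k = S.bb j l ∨ S.D p q := by
  rcases S.SK5 i k j l hik hjl (S.prot_aa hik) (h _ _ hip hjq) (h _ _ hip hlq) (h _ _ hkp hlq)
    (h _ _ hkp hjq) with h | h | h
  · exact Or.inl h
  · exact Or.inr ⟨i, k, j, l, hik, hjl, hip, hkp, hjq, hlq, h⟩
  · exact Or.inr ⟨i, k, l, j, hik, hjl.symm, hip, hkp, hlq, hjq, h⟩

theorem case_prot (h : ∀ i j, S.ab i j ∉ S.W) : False := by
  have hh : ∀ p q, S.Al p q ∨ S.D p q := by
    intro p q
    obtain ⟨a, ha⟩ : ∃ a, a ≠ p := (exists_third p p).imp fun _ h => h.1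
    obtain ⟨b, hb, hba⟩ := exists_third p a
    obtain ⟨c, hc⟩ : ∃ a, a ≠ q := (exists_third q q).imp fun _ h => h.1
    obtain ⟨d, hd, hdc⟩ := exists_third q c
    rcases S.Al_or_D hba.symm hdc.symm ha hb hc hd (fun i j _ _ => h i j) with h | h
    · exact Or.inl ⟨a, b, c, d, hba.symm, hdc.symm, ha, hb, hc, hd, h⟩
    · exact Or.inr h
  have two : ∀ p, ∃ q q', q ≠ q' ∧ S.D p q ∧ S.D p q' := by
    intro p
    by_cases h0 : S.D p 0
    · by_cases h1 : S.D p 1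
      · exact ⟨0, 1, by decide, h0, h1⟩
      · refine ⟨0, 2, by decide, h0, (hh p 2).resolve_left fun h2 => ?_⟩
        exact absurd (S.Al_unique ((hh p 1).resolve_right h1) h2) (by decide)
    · have h0' := (hh p 0).resolve_right h0
      exact ⟨1, 2, by decide, (hh p 1).resolve_left fun h => absurd (S.Al_unique h0' h) (by decide),
        (hh p 2).resolve_left fun h => absurd (S.Al_unique h0' h) (by decide)⟩
  obtain ⟨a, b, hab, ha, hb⟩ := two 1
  obtain ⟨c, d, hcd, hc, hd⟩ := two 2
  refine S.PH 0 ![(1, a), (1, b), (2, c), (2, d)] ?_ ?_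
  · clear ha hb hc hd
    revert a b c d; decide
  · intro m
    fin_cases m
    · exact ⟨ha, by simp⟩
    · exact ⟨hb, by simp⟩
    · exact ⟨hc, by simp⟩
    · exact ⟨hd, by simp⟩

theorem D_two {p q x z y' z' : Fin 3} (hxz : x ≠ z) (hy : y' ≠ z') (hx : x ≠ p) (hz : z ≠ p)
    (hy' : y' ≠ q) (hz' : z' ≠ q) (h : S.D p q) :
    S.ab x y' = S.ab z z' ∨ S.ab x z' = S.ab z y' := by
  obtain ⟨i, k, j, l, hik, hjl, hip, hkp, hjq, hlq, h⟩ := h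
  have h1 : (x = i ∧ z = k) ∨ (x = k ∧ z = i) := by
    clear h hjl hjq hlq hy hy' hz' j l
    revert i k p x z; decide
  have h2 : (y' = j ∧ z' = l) ∨ (y' = l ∧ z' = j) := by
    clear h hik hip hkp hxz hx hz h1
    revert j l q y' z'; decide
  rcases h1 with ⟨rfl, rfl⟩ | ⟨rfl, rfl⟩ <;> rcases h2 with ⟨rfl, rfl⟩ | ⟨rfl, rfl⟩
  · exact Or.inl h
  · exact Or.inr h
  · exact Or.inr h.symm
  · exact Or.inl h.symm

theorem final_case {x y z x' y' z' : Fin 3} (hxy : x ≠ y) (hxz : x ≠ z) (hyz : y ≠ z)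
    (hxy' : x' ≠ y') (hxz' : x' ≠ z') (hyz' : y' ≠ z')
    (hp : ∀ i j, (i, j) ≠ (x, x') → S.ab i j ∉ S.W)
    (h1 : S.aa y z = S.bb y' z') (h2 : S.ab x z' = S.ab z y') (h3 : S.D z x') : False := by
  have m1 : S.Meet (S.aa y z) x x' := S.meet_Al hyz hyz' hxy.symm hxz.symm hxy'.symm hxz'.symm h1
  have m2 : S.Meet (S.ab x z') y x' :=
    S.meet_D hxz hyz'.symm hxy hyz.symm hxz'.symm hxy'.symm h2
  have h4 : S.ab x y' = S.ab y z' := by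
    refine (S.D_two hxy hyz' hxz hyz hxy'.symm hxz'.symm h3).resolve_right fun h => ?_
    have := (m2.2.1 y).1 (h ▸ (S.ab_mem y y').1)
    exact this rfl
  have m3 : S.Meet (S.ab x y') z x' :=
    S.meet_D hxy hyz' hxz hyz hxy'.symm hxz'.symm h4
  refine S.K5gen x z y' z' hxz hyz' (S.seg (false, some z) (false, some y) ∪
    S.seg (false, some y) (true, some y')) ?_ ?_ ?_ ?_ ?_ (S.prot_aa hxz)
    (hp _ _ (by simp [hxy'.symm])) (hp _ _ (by simp [hxz'.symm])) (hp _ _ (by simp [hxz'.symm]))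
    ?_ ?_
  · exact ((S.joined _ _ (adjS false hyz.symm)).mono Set.subset_union_left).trans
      ((S.joined _ _ (adjFT y y')).mono Set.subset_union_right)
  · refine Disjoint.union_right ?_ ?_
    · refine S.seg_disj (adjH false x) (adjS false hyz.symm) (by simp) (by simp) (by simp [hxz])
        (by simp [hxy]) fun e => ?_
      have e1 := (S.pt_mem _ _ (adjH false x)).1
      rw [e, S.pt_symm] at e1
      exact S.not_hub e1 ((m1.2.2 y').2 hxy'.symm)
    · exact S.hub_disj false x (adjX false y y') (by simp) (by simp [hxy.symm])
  · refine Disjoint.union_right ?_ ?_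
    · exact S.hub_disj true z' (adjS false hyz.symm) (by simp) (by simp)
    · have := S.hub_disj true z' (j := y) (adjX false y y').symm (by simp) (by simp [hyz'])
      unfold seg at this ⊢
      rw [Set.union_comm (S.O (false, some y)), S.pt_symm (false, some y)]
      exact this
  · refine Disjoint.union_right ?_ ?_
    · exact S.PS_disj (adjS false hyz.symm) (by simp) (by simp) (S.prot_aa hyz.symm)
    · exact S.PS_disj (adjFT y y') (by simp) (by simp) (hp _ _ (by simp [hxy.symm]))
  · refine Disjoint.union_right ?_ ?_
    · refine S.seg_disj (adjFT x z') (adjS false hyz.symm) (by simp [hxz]) (by simp [hxy])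
        (by simp) (by simp) fun e => ?_
      have := (S.ab_mem x z').1
      rw [ab, e, S.pt_symm] at this
      exact (m1.2.1 x).1 this rfl
    · refine S.seg_disj (adjFT x z') (adjFT y y') (by simp [hxy]) (by simp)
        (by simp) (by simp [hyz'.symm]) fun e => ?_
      have := (S.ab_mem y y').1
      rw [ab, ← e] at this
      exact (m2.2.1 y).1 this rfl
  · intro e
    have := (S.aa_mem hxz).1
    rw [aa, e, ← bb, ← h1] at this
    exact (m1.2.1 x).1 this rfl
  · intro e
    have := (S.ab_mem z z').1
    rw [ab, ← e] at this
    exact (m3.2.1 z).1 this rfl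

theorem case_unprot {x x' : Fin 3} (h : S.ab x x' ∈ S.W) : False := by
  have hD : ∀ p q, S.D p q → p = x ∨ q = x' := by
    intro p q hd
    by_contra! hn
    exact S.prot_ab hd hn.1.symm hn.2.symm h
  have c1 : ∀ q, q ≠ x' → S.D x q := by
    intro q hq
    obtain ⟨p, hp⟩ := S.D_col q
    rcases hD p q hp with rfl | rfl
    · exact hp
    · exact absurd rfl hq
  have c2 : ∀ p, p ≠ x → S.D p x' := by
    intro p hq
    obtain ⟨q, hp⟩ := S.D_row p
    rcases hD p q hp with rfl | rfl
    · exact absurd rfl hq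
    · exact hp
  have hp : ∀ i j, (i, j) ≠ (x, x') → S.ab i j ∉ S.W := by
    intro i j hij
    by_cases hj : j = x'
    · have hi : i ≠ x := fun hi => hij (by rw [hi, hj])
      obtain ⟨q, hq, hq'⟩ := exists_third x' j
      exact S.prot_ab (c1 q hq) hi hq'.symm
    · obtain ⟨p, hp, hp'⟩ := exists_third x i
      exact S.prot_ab (c2 p hp) hp'.symm hj
  obtain ⟨y, hy⟩ : ∃ a, a ≠ x := (exists_third x x).imp fun _ h => h.1
  obtain ⟨z, hz, hzy⟩ := exists_third x y
  obtain ⟨y', hy'⟩ : ∃ a, a ≠ x' := (exists_third x' x').imp fun _ h => h.1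
  obtain ⟨z', hz', hzy'⟩ := exists_third x' y'
  have hA : S.aa y z = S.bb y' z' := by
    refine (S.Al_or_D hzy.symm hzy'.symm hy hz hy' hz' fun i j hi hj =>
      hp i j (by simp [hi])).resolve_right fun hd => ?_
    refine S.PH y ![(z, x'), (x, y'), (x, z'), (x, x')] ?_ ?_
    · clear hd hp hD c1 c2 h
      revert x y z x' y' z'; decide
    · intro m
      fin_cases m
      · exact ⟨c2 z hz, hzy.symm⟩
      · exact ⟨c1 y' hy', hy⟩
      · exact ⟨c1 z' hz', hy⟩
      · exact ⟨hd, hy⟩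
  rcases S.D_two hz.symm hzy'.symm hy.symm hzy hy' hz' (c2 y hy) with e | e
  · exact S.final_case hy.symm hz.symm hzy.symm hz'.symm hy'.symm hzy' hp
      (hA.trans (S.pt_symm _ _)) e (c2 z hz)
  · exact S.final_case hy.symm hz.symm hzy.symm hy'.symm hz'.symm hzy'.symm hp hA e (c2 z hz)

theorem contradiction (S : Sys) : False := by
  by_cases h : ∃ i j, S.ab i j ∈ S.W
  · obtain ⟨i, j, h⟩ := h
    exact S.case_unprot h
  · push Not at h
    exact S.case_prot h

end Sys

/-! ### Extracting the data from a map -/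

open Classical in
/-- a point of `S`, outside of `W` if possible -/
noncomputable def pick (S W : Set Plane) : Plane :=
  if h : (S \ W).Nonempty then h.some else if h : S.Nonempty then h.some else 0

theorem pick_mem {S W : Set Plane} (h : S.Nonempty) : pick S W ∈ S := by
  unfold pick
  split_ifs with h1
  · exact h1.some_mem.1
  · exact h.some_mem

theorem pick_not {S W : Set Plane} {q : Plane} (h : q ∈ S) (h' : q ∉ W) : pick S W ∉ W := by
  unfold pick
  have h1 : (S \ W).Nonempty := ⟨q, h, h'⟩
  rw [dif_pos h1]
  exact h1.some_mem.2

theorem half_join {f : Plane → Plane} (hf : ContinuousOn f (Metric.closedBall 0 1)) {p : Plane}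
    (hp : p ∈ f '' Metric.closedBall 0 1) :
    JoinedIn (f '' Metric.ball 0 1 ∪ {p}) (f 0) p := by
  obtain ⟨x, hx, rfl⟩ := hp
  have hseg : segment ℝ (0 : Plane) x ⊆ Metric.ball 0 1 ∪ {x} := by
    rintro _ ⟨a, b, ha, hb, hab, rfl⟩
    rcases eq_or_lt_of_le ha with h | h
    · right
      have : b = 1 := by linarith
      simp [this]
    · left
      have hx' : ‖x‖ ≤ 1 := by simpa using hx
      simp only [smul_zero, zero_add, mem_ball_zero_iff, norm_smul, Real.norm_eq_abs,
        abs_of_nonneg hb]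
      nlinarith [norm_nonneg x]
  have hsub : Metric.ball (0 : Plane) 1 ∪ {x} ⊆ Metric.closedBall 0 1 :=
    Set.union_subset Metric.ball_subset_closedBall (by simpa using hx)
  have := (JoinedIn.of_segment_subset hseg).map_continuousOn (hf.mono hsub)
  rwa [Set.image_union, Set.image_singleton] at this

theorem no_map (F : Set (Sym2 (VG ⊕ Fin 6))) (hF : ValidSupp F) :
    ¬ IsKMapGraph (pathAdd GG (false, none) (true, none) 6 F) 4 := by
  rintro ⟨R, hd, hinter, hadj, hcard⟩
  choose f hfc hfi hfR using hd
  have hOi : ∀ x, f x '' Metric.ball 0 1 ⊆ interior (R x) := by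
    rintro x _ ⟨a, ha, rfl⟩
    rw [← hfR x]
    exact mem_interior_image (hfc x) (hfi x) (Metric.ball_subset_interior_closedBall ha)
  have hRc : ∀ x, R x ⊆ closure (interior (R x)) := by
    intro x
    calc R x = f x '' closure (Metric.ball 0 1) := by
          rw [closure_ball _ one_ne_zero, hfR]
      _ ⊆ closure (f x '' Metric.ball 0 1) := by
          apply ContinuousOn.image_closure
          rw [closure_ball _ one_ne_zero]
          exact hfc x
      _ ⊆ _ := closure_mono (hOi x)
  have hOR : ∀ x, f x '' Metric.ball 0 1 ⊆ R x := fun x => (hOi x).trans interior_subset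
  have hOd : ∀ x y, x ≠ y → Disjoint (f x '' Metric.ball 0 1) (R y) := fun x y h =>
    ((hinter h).closure_right isOpen_interior).mono (hOi x) (hRc y)
  have hjoin : ∀ x y p, p ∈ R x → p ∈ R y →
      JoinedIn (f x '' Metric.ball 0 1 ∪ f y '' Metric.ball 0 1 ∪ {p}) (f x 0) (f y 0) := by
    intro x y p hx hy
    rw [← hfR] at hx hy
    refine ((half_join (hfc x) hx).mono ?_).trans ((half_join (hfc y) hy).mono ?_).symm
    · exact Set.union_subset_union_left _ Set.subset_union_left
    · exact Set.union_subset_union_left _ Set.subset_union_right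
  have hadj' : ∀ x y : VG, x ≠ y → (GG.Adj x y ↔ (R (Sum.inl x) ∩ R (Sum.inl y)).Nonempty) := by
    intro x y hxy
    rw [← hadj (Sum.inl x) (Sum.inl y) (by simpa using hxy)]
    unfold pathAdd
    rw [SimpleGraph.fromEdgeSet_adj]
    constructor
    · intro h
      exact ⟨Or.inl (Or.inl ⟨s(x, y), h, rfl⟩), by simpa using hxy⟩
    · rintro ⟨(⟨e, he, h⟩ | ⟨i, h⟩) | h, -⟩
      · induction e with
        | _ a b =>
          rw [SimpleGraph.mem_edgeSet] at he
          simp only [Sym2.map_mk, Sym2.eq_iff, Sum.inl.injEq] at h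
          rcases h with ⟨rfl, rfl⟩ | ⟨rfl, rfl⟩
          · exact he
          · exact he.symm
      · exfalso
        fin_cases i <;> simp [chainVertex] at h
      · obtain ⟨-, i, hi⟩ := hF _ h
        simp at hi
  let W : Set Plane := ⋃ w : Fin 6, R (Sum.inr w)
  have hW : ∀ w, R (Sum.inr w) ⊆ W := fun w => Set.subset_iUnion (fun w => R (Sum.inr w)) w
  let u : VG ⊕ Fin 6 := Sum.inl (false, none)
  let v : VG ⊕ Fin 6 := Sum.inl (true, none)
  let PS : Set Plane := f u '' Metric.ball 0 1 ∪ f v '' Metric.ball 0 1 ∪ W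
  have hstep : ∀ x w, x ≠ Sum.inr w → f x '' Metric.ball 0 1 ⊆ PS →
      s(x, Sum.inr w) ∈ chainEdges u v (fun i : Fin 6 => (Sum.inr i : VG ⊕ Fin 6)) →
      JoinedIn PS (f x 0) (f (Sum.inr w) 0) := by
    intro x w hne hx he
    have : (pathAdd GG (false, none) (true, none) 6 F).Adj x (Sum.inr w) := by
      unfold pathAdd
      rw [SimpleGraph.fromEdgeSet_adj]
      exact ⟨Or.inl (Or.inr he), hne⟩
    obtain ⟨p, hp1, hp2⟩ := (hadj _ _ hne).1 this
    refine (hjoin x (Sum.inr w) p hp1 hp2).mono ?_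
    have hWP : W ⊆ PS := Set.subset_union_right
    refine Set.union_subset (Set.union_subset hx (((hOR _).trans (hW w)).trans hWP)) ?_
    exact Set.singleton_subset_iff.2 (hWP (hW w hp2))
  have hOw : ∀ w, f (Sum.inr w) '' Metric.ball 0 1 ⊆ PS := fun w =>
    ((hOR _).trans (hW w)).trans Set.subset_union_right
  have hOu : f u '' Metric.ball 0 1 ⊆ PS := fun p hp => Or.inl (Or.inl hp)
  have hOv : f v '' Metric.ball 0 1 ⊆ PS := fun p hp => Or.inl (Or.inr hp)
  have hpath : JoinedIn PS (f u 0) (f v 0) := by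
    have s0 := hstep u 0 (by simp [u]) hOu ⟨0, rfl⟩
    have s1 := hstep (Sum.inr 0) 1 (by simp) (hOw 0) ⟨1, rfl⟩
    have s2 := hstep (Sum.inr 1) 2 (by simp) (hOw 1) ⟨2, rfl⟩
    have s3 := hstep (Sum.inr 2) 3 (by simp) (hOw 2) ⟨3, rfl⟩
    have s4 := hstep (Sum.inr 3) 4 (by simp) (hOw 3) ⟨4, rfl⟩
    have s5 := hstep (Sum.inr 4) 5 (by simp) (hOw 4) ⟨5, rfl⟩
    have s6 := hstep v 5 (by simp [v]) hOv ⟨6, Sym2.eq_swap⟩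
    exact (((((s0.trans s1).trans s2).trans s3).trans s4).trans s5).trans s6.symm
  have hfive : ∀ p (x y z w s : VG ⊕ Fin 6), x ≠ y → x ≠ z → x ≠ w → y ≠ z → y ≠ w → z ≠ w →
      p ∈ R x → p ∈ R y → p ∈ R z → p ∈ R w → p ∈ R s → s = x ∨ s = y ∨ s = z ∨ s = w := by
    intro p x y z w s h1 h2 h3 h4 h5 h6 hx hy hz hw hs
    by_contra! hn
    have hc := hcard p
    have hsub : (({x, y, z, w, s} : Finset (VG ⊕ Fin 6)) : Set (VG ⊕ Fin 6)) ⊆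
        {x | p ∈ R x} := by
      intro a ha
      simp only [Finset.coe_insert, Finset.coe_singleton, Set.mem_insert_iff,
        Set.mem_singleton_iff] at ha
      rcases ha with rfl | rfl | rfl | rfl | rfl <;> assumption
    have hle := Set.ncard_le_ncard hsub (Set.toFinite _)
    rw [Set.ncard_coe_finset] at hle
    have : ({x, y, z, w, s} : Finset (VG ⊕ Fin 6)).card = 5 := by
      simp [Finset.card_insert_of_notMem, h1, h2, h3, h4, h5, h6, hn.1.symm, hn.2.1.symm,
        hn.2.2.1.symm, hn.2.2.2.symm]
    omega
  refine Sys.contradiction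
    { R := fun x => R (Sum.inl x)
      O := fun x => f (Sum.inl x) '' Metric.ball 0 1
      c := fun x => f (Sum.inl x) 0
      W := W
      pt := fun x y => pick (R (Sum.inl x) ∩ R (Sum.inl y)) W
      hOR := fun x => hOR _
      hOd := fun x y h => hOd _ _ (by simpa using h)
      hOW := fun x => Set.disjoint_iUnion_right.2 fun w => hOd _ _ (by simp)
      adj := fun x y h hne => (hadj' x y h).2 hne
      pt_symm := fun x y => by rw [Set.inter_comm]
      pt_mem := fun x y h => pick_mem ((hadj' x y h.ne).1 h)
      pt_prot := fun x y q h h1 h2 h3 => pick_not ⟨h1, h2⟩ h3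
      joined := fun x y h => by
        have := pick_mem (W := W) ((hadj' x y h.ne).1 h)
        exact hjoin _ _ _ this.1 this.2
      four := fun p x y z w h1 h2 h3 h4 h5 h6 hx hy hz hw => by
        have key := fun s => hfive p (Sum.inl x) (Sum.inl y) (Sum.inl z) (Sum.inl w) s
          (by simpa using h1) (by simpa using h2) (by simpa using h3) (by simpa using h4)
          (by simpa using h5) (by simpa using h6) hx hy hz hw
        refine ⟨fun hp => ?_, fun s hs => by simpa using key _ hs⟩
        obtain ⟨i, hi⟩ := Set.mem_iUnion.1 hp
        simpa using key _ hi
      path := hpath }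

/-- The class of 4-map graphs is not closed under path-addition: there
are a 4-map graph `G`, distinct vertices `u, v`, and a path of length at least
`|V(G)| - 1` with new internal vertices such that for every supplementary edge set the
resulting graph is not a 4-map graph. -/
theorem fourMap_not_closedUnderPathAddition :
    ∃ (V : Type) (iV : Fintype V) (G : SimpleGraph V),
      IsKMapGraph G 4 ∧
      ∃ u v : V, u ≠ v ∧
        ∃ t : ℕ, @Fintype.card V iV - 1 ≤ t + 1 ∧
          ∀ F : Set (Sym2 (V ⊕ Fin t)), ValidSupp F →
            ¬ IsKMapGraph (pathAdd G u v t F) 4 := by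
  exact ⟨VG, inferInstance, GG, GG_isMap, (false, none), (true, none), by decide, 6, by decide,
    no_map⟩
end
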